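/- arXiv:math/0302341 — 4 statements merged into one kernel-verified Lean document; each statement's English description precedes it below -/
import Mathlib

section
/- Let K be an infinite field and m, n, t positive integers. The subalgebra of GL_t(K)-invariants of the polynomial algebra O(M_{m,t}) ⊗ O(M_{t,n}) = K[Y_{ik}, Z_{kj}] — i.e., the set of polynomials f with σ_g(f) = f for every g ∈ GL_t(K) — equals the image of the algebra morphism θ* : K[X_{ij}] → K[Y_{ik}, Z_{kj}] determined by θ*(X_{ij}) = Σ_{k=1}^t Y_{ik} Z_{kj}. -/
open MvPolynomial

namespace GLInvariants

section Lower

variable {σ K Γ : Type*} [CommRing K] [AddCommMonoid Γ] [LinearOrder Γ]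

/-- Polynomials all of whose exponents have `Θ`-weight below `b`. -/
noncomputable abbrev lowerPart (K : Type*) [CommRing K] (Θ : (σ →₀ ℕ) →+ Γ) (b : Γ) :
    Submodule K (MvPolynomial σ K) :=
  restrictSupport K {e | Θ e < b}

/-- Polynomials all of whose exponents have `Θ`-weight at most `b`. -/
noncomputable abbrev lowerEqPart (K : Type*) [CommRing K] (Θ : (σ →₀ ℕ) →+ Γ) (b : Γ) :
    Submodule K (MvPolynomial σ K) :=
  restrictSupport K {e | Θ e ≤ b}

theorem lowerPart_le_lowerEqPart (Θ : (σ →₀ ℕ) →+ Γ) (b : Γ) :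
    lowerPart K Θ b ≤ lowerEqPart K Θ b :=
  restrictSupport_mono K fun _ he => le_of_lt he

theorem lowerPart_mono (Θ : (σ →₀ ℕ) →+ Γ) {b c : Γ} (h : b ≤ c) :
    lowerPart K Θ b ≤ lowerPart K Θ c :=
  restrictSupport_mono K fun _ he => lt_of_lt_of_le he h

theorem mul_mem_restrictSupport {s t u : Set (σ →₀ ℕ)} {p q : MvPolynomial σ K}
    (hp : p ∈ restrictSupport K s) (hq : q ∈ restrictSupport K t)
    (h : ∀ a ∈ s, ∀ b ∈ t, a + b ∈ u) : p * q ∈ restrictSupport K u := by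
  refine restrictSupport_mono K (Set.add_subset_iff.2 h) ?_
  rw [restrictSupport_add]
  exact Submodule.mul_mem_mul hp hq

/-- `p` and `q` have weight at most `b` and agree up to terms of smaller weight. -/
structure LeadCongr (Θ : (σ →₀ ℕ) →+ Γ) (b : Γ) (p q : MvPolynomial σ K) : Prop where
  left : p ∈ lowerEqPart K Θ b
  right : q ∈ lowerEqPart K Θ b
  sub : p - q ∈ lowerPart K Θ b

theorem LeadCongr.one (Θ : (σ →₀ ℕ) →+ Γ) : LeadCongr (K := K) Θ 0 1 1 where
  left := (monomial_mem_restrictSupport K (m := 0) (r := (1 : K))).2 (Or.inl (by simp))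
  right := (monomial_mem_restrictSupport K (m := 0) (r := (1 : K))).2 (Or.inl (by simp))
  sub := by simp

theorem LeadCongr.of_right {Θ : (σ →₀ ℕ) →+ Γ} {b : Γ} {p q : MvPolynomial σ K}
    (hq : q ∈ lowerEqPart K Θ b) (h : p - q ∈ lowerPart K Θ b) : LeadCongr Θ b p q where
  left := by simpa using add_mem (lowerPart_le_lowerEqPart Θ _ h) hq
  right := hq
  sub := h

theorem X_mem_lowerEqPart (Θ : (σ →₀ ℕ) →+ Γ) (s : σ) :
    X s ∈ lowerEqPart K Θ (Θ (Finsupp.single s 1)) :=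
  (monomial_mem_restrictSupport K).2 (Or.inl (le_refl (Θ (Finsupp.single s 1))))

theorem leadCongr_of_sub_mem {Θ : (σ →₀ ℕ) →+ Γ} {D : σ →₀ ℕ} {r : MvPolynomial σ K}
    (h : r - monomial D 1 ∈ lowerPart K Θ (Θ D)) : LeadCongr Θ (Θ D) r (monomial D 1) :=
  .of_right ((monomial_mem_restrictSupport K).2 (Or.inl (le_refl (Θ D)))) h

variable [IsOrderedCancelAddMonoid Γ]

theorem LeadCongr.mul {Θ : (σ →₀ ℕ) →+ Γ} {b b' : Γ} {p q p' q' : MvPolynomial σ K}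
    (h : LeadCongr Θ b p q) (h' : LeadCongr Θ b' p' q') :
    LeadCongr Θ (b + b') (p * p') (q * q') where
  left := mul_mem_restrictSupport h.left h'.left fun x hx y hy => by
    simpa using add_le_add hx hy
  right := mul_mem_restrictSupport h.right h'.right fun x hx y hy => by
    simpa using add_le_add hx hy
  sub := by
    have : p * p' - q * q' = (p - q) * p' + q * (p' - q') := by ring
    rw [this]
    refine add_mem (mul_mem_restrictSupport h.sub h'.left fun x hx y hy => ?_)
      (mul_mem_restrictSupport h.right h'.sub fun x hx y hy => ?_)
    · simpa using add_lt_add_of_lt_of_le hx hy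
    · simpa using add_lt_add_of_le_of_lt hx hy

theorem leadCongr_aeval_monomial {Θ : (σ →₀ ℕ) →+ Γ} {G H : σ → MvPolynomial σ K}
    (h : ∀ s, LeadCongr Θ (Θ (Finsupp.single s 1)) (G s) (H s)) (e : σ →₀ ℕ) :
    LeadCongr Θ (Θ e) (aeval G (monomial e (1 : K))) (aeval H (monomial e (1 : K))) := by
  induction e using Finsupp.induction_linear with
  | zero => simpa using LeadCongr.one (K := K) Θ
  | add e e' he he' =>
    have : monomial (e + e') (1 : K) = monomial e 1 * monomial e' 1 := by simp
    rw [this, map_mul, map_mul, map_add]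
    exact he.mul he'
  | single s n =>
    induction n with
    | zero => simpa using LeadCongr.one (K := K) Θ
    | succ n ih =>
      have : monomial (Finsupp.single s (n + 1)) (1 : K)
          = monomial (Finsupp.single s n) 1 * X s := by
        simp [X, Finsupp.single_add]
      rw [this, map_mul, map_mul, aeval_X, aeval_X, Finsupp.single_add, map_add]
      exact ih.mul (h s)

theorem aeval_sub_aeval_mem_lowerPart {Θ : (σ →₀ ℕ) →+ Γ} {G H : σ → MvPolynomial σ K}
    (h : ∀ s, LeadCongr Θ (Θ (Finsupp.single s 1)) (G s) (H s)) {b : Γ} {f : MvPolynomial σ K}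
    (hf : ∀ e ∈ f.support, Θ e ≤ b) : aeval G f - aeval H f ∈ lowerPart K Θ b := by
  rw [f.as_sum, map_sum, map_sum, ← Finset.sum_sub_distrib]
  refine sum_mem fun e he => ?_
  have h1 : monomial e (coeff e f) = C (coeff e f) * monomial e (1 : K) := by
    rw [C_mul_monomial, mul_one]
  rw [h1, ← algebraMap_eq, ← Algebra.smul_def, map_smul, map_smul, ← smul_sub]
  exact Submodule.smul_mem _ _ (lowerPart_mono Θ (hf e he) (leadCongr_aeval_monomial h e).sub)

end Lower

section Translation

variable {K : Type*} [Field K]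

/-- The translation `X i ↦ X i + c` with a formal parameter `c`. -/
noncomputable def translate (K : Type*) [Field K] (q : ℕ) :
    MvPolynomial (Fin q) K →+* MvPolynomial (Fin q) (Polynomial K) :=
  eval₂Hom (C.comp Polynomial.C) fun i => X i + C Polynomial.X

/-- Polynomials over `K[c]` whose degree in `c` is less than `d`. -/
def paramDegreeLT (K : Type*) [Field K] (q d : ℕ) :
    AddSubgroup (MvPolynomial (Fin q) (Polynomial K)) where
  carrier := {a | ∀ e, ∀ j, d ≤ j → (coeff e a).coeff j = 0}
  add_mem' := fun ha hb e j hj => by simp [ha e j hj, hb e j hj]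
  zero_mem' := by simp
  neg_mem' := fun ha e j hj => by simp [ha e j hj]

variable {q : ℕ}

@[simp]
theorem translate_C (r : K) : translate K q (C r) = C (Polynomial.C r) := by
  simp [translate]

@[simp]
theorem translate_X (i : Fin q) : translate K q (X i) = X i + C Polynomial.X := by
  simp [translate]

theorem paramDegreeLT_mono {d d' : ℕ} (h : d ≤ d') : paramDegreeLT K q d ≤ paramDegreeLT K q d' :=
  fun _ ha e j hj => ha e j (h.trans hj)

theorem eq_zero_of_mem_paramDegreeLT_zero {a : MvPolynomial (Fin q) (Polynomial K)}
    (ha : a ∈ paramDegreeLT K q 0) : a = 0 := by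
  ext e j
  simpa using ha e j (Nat.zero_le j)

theorem mem_paramDegreeLT_of_mul {d : ℕ} {a : MvPolynomial (Fin q) (Polynomial K)}
    (ha : C Polynomial.X * a ∈ paramDegreeLT K q d) : a ∈ paramDegreeLT K q (d - 1) := by
  intro e j hj
  simpa using ha e (j + 1) (by omega)

theorem mul_pow_mem_paramDegreeLT {d k : ℕ} {a : MvPolynomial (Fin q) (Polynomial K)}
    (ha : a ∈ paramDegreeLT K q d) :
    a * (-C Polynomial.X) ^ k ∈ paramDegreeLT K q (d + k) := by
  induction k with
  | zero => simpa using ha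
  | succ k ih =>
    have h : a * (-C Polynomial.X) ^ (k + 1) = -(C Polynomial.X * (a * (-C Polynomial.X) ^ k)) := by
      ring
    rw [h]
    refine neg_mem fun e j hj => ?_
    obtain ⟨j, rfl⟩ := Nat.exists_eq_add_of_lt hj
    simpa using ih e (d + k + j) (by omega)

theorem coeff_mem_paramDegreeLT_of_mul {d : ℕ}
    {R : Polynomial (MvPolynomial (Fin q) (Polynomial K))}
    (hR : ∀ j, ((Polynomial.X + Polynomial.C (C Polynomial.X)) * R).coeff j
      ∈ paramDegreeLT K q d) (j : ℕ) : R.coeff j ∈ paramDegreeLT K q (d - 1) := by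
  apply mem_paramDegreeLT_of_mul
  induction j with
  | zero => simpa [add_mul] using hR 0
  | succ j ih =>
    have h1 := paramDegreeLT_mono (Nat.sub_le d 1) (mem_paramDegreeLT_of_mul ih)
    simpa [add_mul] using sub_mem (hR (j + 1)) h1

theorem coeff_mem_paramDegreeLT_of_pow_mul {d b : ℕ}
    {R : Polynomial (MvPolynomial (Fin q) (Polynomial K))}
    (hR : ∀ j, ((Polynomial.X + Polynomial.C (C Polynomial.X)) ^ b * R).coeff j
      ∈ paramDegreeLT K q d) (j : ℕ) : R.coeff j ∈ paramDegreeLT K q (d - b) := by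
  induction b generalizing d j with
  | zero => simpa using hR j
  | succ b ih =>
    have := ih (d := d - 1) (fun j => coeff_mem_paramDegreeLT_of_mul (fun j => by
      rw [← mul_assoc, ← pow_succ']
      exact hR j) j) j
    rwa [Nat.sub_sub, add_comm 1 b] at this

theorem translate_injective : Function.Injective (translate K q) := by
  have h : (map (Polynomial.evalRingHom (0 : K))).comp (translate K q) = RingHom.id _ := by
    refine ringHom_ext (fun r => ?_) (fun i => ?_) <;> simp
  exact Function.LeftInverse.injective (g := map (Polynomial.evalRingHom (0 : K)))
    fun x => RingHom.congr_fun h x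

theorem finSuccEquiv_translate (p : MvPolynomial (Fin (q + 1)) K) :
    finSuccEquiv (Polynomial K) q (translate K (q + 1) p) =
      Polynomial.eval₂ (Polynomial.C.comp (translate K q))
        (Polynomial.X + Polynomial.C (C Polynomial.X)) (finSuccEquiv K q p) := by
  have h : ((finSuccEquiv (Polynomial K) q : _ →+* _)).comp (translate K (q + 1)) =
      (Polynomial.eval₂RingHom (Polynomial.C.comp (translate K q))
        (Polynomial.X + Polynomial.C (C Polynomial.X))).comp
        (finSuccEquiv K q : _ →+* _) := by
    refine ringHom_ext (fun r => ?_) (fun i => ?_)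
    · simp [finSuccEquiv_apply]
    · refine Fin.cases ?_ (fun i => ?_) i <;> simp [finSuccEquiv_apply]
  exact RingHom.congr_fun h p

/-- If translating `p` has degree at most `d` in the translation parameter, then the
lexicographically smallest exponent of `p` is bounded by `d` and the partial degrees of `p`. -/
theorem sum_le_of_translate_mem (q : ℕ) (p : MvPolynomial (Fin q) K) (N : Fin q → ℕ) (d : ℕ)
    (β : Fin q →₀ ℕ) (hN : ∀ e ∈ p.support, ∀ i, e i ≤ N i)
    (hp : translate K q p ∈ paramDegreeLT K q (d + 1)) (hβ : β ∈ p.support)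
    (hmin : ∀ e ∈ p.support, toLex (⇑β) ≤ toLex (⇑e)) (s : Fin q) :
    (∑ i, if i ≤ s then β i else 0) + (∑ i, if i < s then β i else 0) ≤
      d + ∑ i, if i < s then N i else 0 := by
  induction q generalizing d with
  | zero => exact s.elim0
  | succ q ih =>
    set b := β 0 with hb
    have hcons : ∀ e' y, coeff e' ((finSuccEquiv K q p).coeff y) ≠ 0 →
        Finsupp.cons y e' ∈ p.support := fun e' y h => by
      rwa [mem_support_iff, ← finSuccEquiv_coeff_coeff]
    have hdvd : Polynomial.X ^ b ∣ finSuccEquiv K q p := by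
      rw [Polynomial.X_pow_dvd_iff]
      intro y hy
      ext e'
      by_contra h
      refine absurd (hmin _ (hcons e' y h)) (not_le.2 ?_)
      exact ⟨0, by simp, by simpa using hy⟩
    obtain ⟨r, hr⟩ := hdvd
    have hr0 : r.coeff 0 = (finSuccEquiv K q p).coeff b := by
      rw [hr]; simpa using (Polynomial.coeff_X_pow_mul r b 0).symm
    have hβ' : β.tail ∈ (r.coeff 0).support := by
      rw [hr0, mem_support_iff, finSuccEquiv_coeff_coeff, hb, Finsupp.cons_tail]
      exact mem_support_iff.1 hβ
    have hp0 : r.coeff 0 ≠ 0 := fun h => by simp [h] at hβ'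
    have hr_ne : r ≠ 0 := fun h => hp0 (by simp [h])
    set R := Polynomial.eval₂ (Polynomial.C.comp (translate K q))
      (Polynomial.X + Polynomial.C (C Polynomial.X)) r with hR
    have hmul : finSuccEquiv (Polynomial K) q (translate K (q + 1) p) =
        (Polynomial.X + Polynomial.C (C Polynomial.X)) ^ b * R := by
      rw [finSuccEquiv_translate, hr, Polynomial.eval₂_mul, Polynomial.eval₂_X_pow]
    have hRcoeff : ∀ j, R.coeff j ∈ paramDegreeLT K q (d + 1 - b) := by
      refine coeff_mem_paramDegreeLT_of_pow_mul fun j => ?_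
      rw [← hmul]
      intro e
      rw [finSuccEquiv_coeff_coeff]
      exact hp _
    have heval : R.eval (-C Polynomial.X) = translate K q (r.coeff 0) := by
      have h : ((Polynomial.evalRingHom (-C Polynomial.X)).comp
          (Polynomial.eval₂RingHom (Polynomial.C.comp (translate K q))
            (Polynomial.X + Polynomial.C (C Polynomial.X)))) =
          (translate K q).comp Polynomial.constantCoeff := by
        refine Polynomial.ringHom_ext (fun a => ?_) ?_ <;> simp
      exact RingHom.congr_fun h r
    have hbd : b ≤ d := by
      by_contra hlt
      have : R = 0 := by
        ext1 j
        have := hRcoeff j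
        rw [show d + 1 - b = 0 by omega] at this
        simpa using eq_zero_of_mem_paramDegreeLT_zero this
      rw [this, Polynomial.eval_zero] at heval
      exact hp0 (translate_injective (by rw [← heval, map_zero]))
    have hRdeg : R.natDegree ≤ r.natDegree := by
      rw [hR, Polynomial.eval₂_eq_sum_range]
      refine Polynomial.natDegree_sum_le_of_forall_le _ _ fun j hj => ?_
      refine (Polynomial.natDegree_mul_le).trans ?_
      rw [RingHom.comp_apply, Polynomial.natDegree_C, zero_add]
      refine (Polynomial.natDegree_pow_le).trans ?_
      rw [Polynomial.natDegree_X_add_C, mul_one]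
      exact Nat.lt_succ_iff.1 (Finset.mem_range.1 hj)
    have hrdeg : b + r.natDegree ≤ N 0 := by
      have : b + r.natDegree = (finSuccEquiv K q p).natDegree := by
        rw [hr, Polynomial.natDegree_mul (by simp) hr_ne, Polynomial.natDegree_X_pow]
      rw [this, natDegree_finSuccEquiv, degreeOf_le_iff]
      exact fun e he => hN e he 0
    have hmem : translate K q (r.coeff 0) ∈ paramDegreeLT K q ((d - b + (N 0 - b)) + 1) := by
      rw [← heval, Polynomial.eval_eq_sum_range]
      refine sum_mem fun j hj => ?_
      refine paramDegreeLT_mono ?_ (mul_pow_mem_paramDegreeLT (hRcoeff j))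
      have := Finset.mem_range.1 hj
      omega
    have key := ih (r.coeff 0) (fun i => N i.succ) _ β.tail (fun e he i => by
        simpa using hN _ (hcons e b (by rwa [← hr0, ← mem_support_iff])) i.succ) hmem hβ'
      (fun e he => by
        have h := hmin _ (hcons e b (by rwa [← hr0, ← mem_support_iff]))
        rcases h.lt_or_eq with ⟨i, hi, hlt⟩ | h
        · revert hi hlt
          refine Fin.cases (fun _ hlt => ?_) (fun i hi hlt => ?_) i
          · simp [hb] at hlt
          · refine le_of_lt ⟨i, fun j hj => ?_, ?_⟩
            · simpa [Finsupp.tail_apply] using hi j.succ (by simpa using hj)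
            · simpa [Finsupp.tail_apply] using hlt
        · refine le_of_eq (congrArg toLex (funext fun i => ?_))
          simpa [Finsupp.tail_apply] using congrFun (toLex.injective h) i.succ)
    revert key
    refine Fin.cases (fun _ => ?_) (fun s key => ?_) s
    · simpa [Fin.sum_univ_succ, ← hb] using hbd
    · have := key s
      simp only [Fin.sum_univ_succ, Fin.zero_le, if_true, Fin.succ_pos, Fin.succ_le_succ_iff,
        Fin.succ_lt_succ_iff, Finsupp.tail_apply] at this ⊢
      omega

end Translation

section Shear

open Function

variable {σ K : Type*} [Field K] {q : ℕ} {u v : Fin q → σ}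

/-- The substitution `X (v i) ↦ X (v i) + c * X (u i)`, fixing the other variables. -/
noncomputable def shear (u v : Fin q → σ) (c : K) : σ → MvPolynomial σ K :=
  extend v (fun i => X (v i) + C c * X (u i)) X

/-- Replace each exponent of `v i` by the same exponent of `u i`. -/
noncomputable def merge (u v : Fin q → σ) : (σ →₀ ℕ) →+ (σ →₀ ℕ) :=
  Finsupp.mapDomain.addMonoidHom (extend v u id)

theorem merge_single_apply_range (hv : Injective v) (i : Fin q) (n : ℕ) :
    merge u v (Finsupp.single (v i) n) = Finsupp.single (u i) n := by
  simp [merge, Finsupp.mapDomain_single, hv.extend_apply]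

theorem merge_single_of_notMem {s : σ} (hs : ¬∃ i, v i = s) (n : ℕ) :
    merge u v (Finsupp.single s n) = Finsupp.single s n := by
  simp [merge, Finsupp.mapDomain_single, extend_apply' _ _ _ hs]

theorem merge_apply_left (hu : Injective u) (hv : Injective v) (huv : ∀ i j, u i ≠ v j)
    (e : σ →₀ ℕ) (i : Fin q) : merge u v e (u i) = e (u i) + e (v i) := by
  classical
  induction e using Finsupp.induction_linear with
  | zero => simp
  | add e e' he he' => simp only [map_add, Finsupp.add_apply, he, he']; ring
  | single s n =>
    by_cases hs : ∃ j, v j = s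
    · obtain ⟨j, rfl⟩ := hs
      simp [merge_single_apply_range hv, Finsupp.single_apply, hu.eq_iff, hv.eq_iff,
        (huv i j).symm]
    · have : s ≠ v i := fun h => hs ⟨i, h.symm⟩
      simp [merge_single_of_notMem hs, Finsupp.single_apply, this]

theorem merge_apply_of_notMem (hv : Injective v) (e : σ →₀ ℕ) {s : σ} (hs : ¬∃ i, v i = s)
    (hs' : ¬∃ i, u i = s) : merge u v e s = e s := by
  classical
  induction e using Finsupp.induction_linear with
  | zero => simp
  | add e e' he he' => simp only [map_add, Finsupp.add_apply, he, he']
  | single s' n =>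
    by_cases h : ∃ j, v j = s'
    · obtain ⟨j, rfl⟩ := h
      have h1 : v j ≠ s := fun h => hs ⟨j, h⟩
      have h2 : u j ≠ s := fun h => hs' ⟨j, h⟩
      simp [merge_single_apply_range hv, h1, h2]
    · simp [merge_single_of_notMem h]

theorem eq_of_merge_eq (hu : Injective u) (hv : Injective v) (huv : ∀ i j, u i ≠ v j)
    {e e' : σ →₀ ℕ} (h : merge u v e = merge u v e') (h' : ∀ i, e (v i) = e' (v i)) :
    e = e' := by
  ext s
  by_cases hs : ∃ i, v i = s
  · obtain ⟨i, rfl⟩ := hs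
    exact h' i
  by_cases hs' : ∃ i, u i = s
  · obtain ⟨i, rfl⟩ := hs'
    have := DFunLike.congr_fun h (u i)
    rw [merge_apply_left hu hv huv, merge_apply_left hu hv huv, h' i] at this
    exact Nat.add_right_cancel this
  · simpa [merge_apply_of_notMem hv _ hs hs'] using DFunLike.congr_fun h s

/-- The dehomogenization `X (v i) ↦ T i * X (u i)`, where `T` is a new set of variables. -/
noncomputable def slope (K : Type*) [Field K] (u v : Fin q → σ) :
    MvPolynomial σ K →+* MvPolynomial σ (MvPolynomial (Fin q) K) :=
  eval₂Hom (C.comp C) (extend v (fun i => C (X i) * X (u i)) X)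

theorem slope_X_apply (hv : Injective v) (i : Fin q) :
    slope K u v (X (v i)) = C (X i) * X (u i) := by
  simp [slope, hv.extend_apply]

theorem slope_X_of_notMem {s : σ} (hs : ¬∃ i, v i = s) : slope K u v (X s) = X s := by
  simp [slope, extend_apply' _ _ _ hs]

theorem slope_C (r : K) : slope K u v (C r) = C (C r) := by
  simp [slope]

theorem slope_monomial_one (hv : Injective v) (e : σ →₀ ℕ) :
    slope K u v (monomial e 1) =
      monomial (merge u v e) (monomial (e.comapDomain v hv.injOn) 1) := by
  induction e using Finsupp.induction_linear with
  | zero =>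
    have : (0 : σ →₀ ℕ).comapDomain v hv.injOn = 0 := by ext; simp
    rw [this, map_zero, monomial_zero', monomial_zero', monomial_zero']
    simp
  | add e e' he he' =>
    have h : monomial (e + e') (1 : K) = monomial e 1 * monomial e' 1 := by simp
    rw [h, map_mul, he, he', Finsupp.comapDomain_add_of_injective hv, map_add, monomial_mul,
      monomial_mul, one_mul]
  | single s n =>
    rw [← X_pow_eq_monomial, map_pow]
    by_cases hs : ∃ i, v i = s
    · obtain ⟨i, rfl⟩ := hs
      have : (Finsupp.single (v i) n).comapDomain v hv.injOn = Finsupp.single i n := by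
        simp
      rw [slope_X_apply hv, merge_single_apply_range hv, this, mul_pow, ← C_pow,
        X_pow_eq_monomial, X_pow_eq_monomial, C_mul_monomial, mul_one]
    · have : (Finsupp.single s n).comapDomain v hv.injOn = 0 := by
        classical
        ext i
        have : s ≠ v i := fun h => hs ⟨i, h.symm⟩
        simp [this]
      rw [slope_X_of_notMem hs, merge_single_of_notMem hs, this, X_pow_eq_monomial]
      rfl

theorem coeff_slope [DecidableEq σ] (hv : Injective v) (f : MvPolynomial σ K) (d : σ →₀ ℕ) :
    coeff d (slope K u v f) = ∑ e ∈ f.support with merge u v e = d,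
      monomial (e.comapDomain v hv.injOn) (coeff e f) := by
  conv_lhs => rw [f.as_sum]
  rw [map_sum, coeff_sum, Finset.sum_filter]
  refine Finset.sum_congr rfl fun e _ => ?_
  have h : monomial e (coeff e f) = C (coeff e f) * monomial e (1 : K) := by
    rw [C_mul_monomial, mul_one]
  rw [h, map_mul, slope_monomial_one hv, slope_C, C_mul_monomial, coeff_monomial, C_mul_monomial,
    mul_one]

theorem slope_aeval_shear (hv : Injective v) (huv : ∀ i j, u i ≠ v j) (c : K)
    (f : MvPolynomial σ K) :
    slope K u v (aeval (shear u v c) f) =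
      map ((map (Polynomial.evalRingHom c)).comp (translate K q)) (slope K u v f) := by
  have h : (slope K u v).comp (aeval (shear u v c) : _ →ₐ[K] _).toRingHom =
      (map ((map (Polynomial.evalRingHom c)).comp (translate K q))).comp (slope K u v) := by
    refine ringHom_ext (fun r => ?_) (fun s => ?_)
    · simp [slope_C, algebraMap_eq]
    · by_cases hs : ∃ i, v i = s
      · obtain ⟨i, rfl⟩ := hs
        have hi : ¬∃ j, v j = u i := fun ⟨j, hj⟩ => huv i j hj.symm
        simp [shear, hv.extend_apply, slope_X_apply hv, slope_X_of_notMem hi, slope_C, add_mul]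
      · simp [shear, extend_apply' _ _ _ hs, slope_X_of_notMem hs]
  exact RingHom.congr_fun h f

variable {Γ : Type*} [AddCommMonoid Γ]

theorem weight_merge {ω : (σ →₀ ℕ) →+ Γ} (hv : Injective v)
    (hωu : ∀ i n, ω (Finsupp.single (u i) n) = 0) (hωv : ∀ i n, ω (Finsupp.single (v i) n) = 0)
    (e : σ →₀ ℕ) : ω (merge u v e) = ω e := by
  induction e using Finsupp.induction_linear with
  | zero => simp
  | add e e' he he' => simp only [map_add, he, he']
  | single s n =>
    by_cases hs : ∃ i, v i = s
    · obtain ⟨i, rfl⟩ := hs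
      rw [merge_single_apply_range hv, hωu, hωv]
    · rw [merge_single_of_notMem hs]

variable [LinearOrder Γ] [IsOrderedCancelAddMonoid Γ]

/-- Let `f` be invariant under substitutions that agree with the shears
`X (v i) ↦ X (v i) + c * X (u i)` up to terms of smaller weight. Then the exponent of top weight
of `f` for which the exponents of the `v i` are lexicographically minimal has the strict column
property for the pair `u, v`. -/
theorem sum_le_sum_of_shear_invariant [Infinite K] (hu : Injective u) (hv : Injective v)
    (huv : ∀ i j, u i ≠ v j) {ω : (σ →₀ ℕ) →+ Γ}
    (hωu : ∀ i n, ω (Finsupp.single (u i) n) = 0) (hωv : ∀ i n, ω (Finsupp.single (v i) n) = 0)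
    {G : K → σ → MvPolynomial σ K}
    (hG : ∀ c s, LeadCongr ω (ω (Finsupp.single s 1)) (G c s) (shear u v c s))
    {f : MvPolynomial σ K} (hf : ∀ c, aeval (G c) f = f) {D : σ →₀ ℕ} (hD : D ∈ f.support)
    (hmax : ∀ e ∈ f.support, ω e ≤ ω D)
    (hmin : ∀ e ∈ f.support, merge u v e = merge u v D →
      toLex (fun i => D (v i)) ≤ toLex (fun i => e (v i))) (s : Fin q) :
    (∑ i, if i ≤ s then D (v i) else 0) ≤ ∑ i, if i < s then D (u i) else 0 := by
  classical
  set p := coeff (merge u v D) (slope K u v f) with hp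
  have hinv : ∀ c : K, map (Polynomial.evalRingHom c) (translate K q p) = p := by
    intro c
    have h1 : coeff (merge u v D) (slope K u v (aeval (G c) f - aeval (shear u v c) f)) = 0 := by
      rw [coeff_slope hv]
      refine Finset.sum_eq_zero fun e he => ?_
      rw [Finset.mem_filter] at he
      have h2 : ω e < ω D := aeval_sub_aeval_mem_lowerPart (hG c) hmax he.1
      rw [← weight_merge hv hωu hωv e, ← weight_merge hv hωu hωv D, he.2] at h2
      exact absurd h2 (lt_irrefl _)
    rw [hf, map_sub, coeff_sub, sub_eq_zero, slope_aeval_shear hv huv, coeff_map] at h1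
    exact h1.symm
  have hsupp : ∀ e ∈ p.support, ∃ E ∈ f.support, merge u v E = merge u v D ∧
      ∀ i, E (v i) = e i := by
    intro e he
    rw [mem_support_iff, hp, coeff_slope hv, coeff_sum] at he
    obtain ⟨E, hE, hne⟩ := Finset.exists_ne_zero_of_sum_ne_zero he
    rw [coeff_monomial] at hne
    rw [Finset.mem_filter] at hE
    refine ⟨E, hE.1, hE.2, fun i => ?_⟩
    have : E.comapDomain v hv.injOn = e := by
      by_contra h
      simp [h] at hne
    rw [← this]
    simp
  have hDp : D.comapDomain v hv.injOn ∈ p.support := by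
    rw [mem_support_iff, hp, coeff_slope hv, coeff_sum, Finset.sum_eq_single D]
    · rw [coeff_monomial, if_pos rfl]
      exact mem_support_iff.1 hD
    · intro E hE hne
      rw [coeff_monomial, if_neg]
      intro h
      refine hne (eq_of_merge_eq hu hv huv (Finset.mem_filter.1 hE).2 fun i => ?_)
      simpa using DFunLike.congr_fun h i
    · intro h
      exact absurd (by simpa using hD) h
  have key := sum_le_of_translate_mem q p (fun i => merge u v D (u i)) 0
    (D.comapDomain v hv.injOn) (fun e he i => by
      obtain ⟨E, -, hE, hEe⟩ := hsupp e he
      rw [← hE, merge_apply_left hu hv huv, hEe]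
      exact Nat.le_add_left _ _)
    (fun e j hj => by
      have h : coeff e (translate K q p) = Polynomial.C (coeff e p) := by
        refine Polynomial.funext fun c => ?_
        rw [Polynomial.eval_C, ← Polynomial.coe_evalRingHom, ← coeff_map, hinv]
      rw [h, Polynomial.coeff_C, if_neg (by omega)])
    hDp (fun e he => by
      obtain ⟨E, hE, hEm, hEe⟩ := hsupp e he
      have : toLex (⇑e) = toLex fun i => E (v i) := congrArg toLex (funext fun i => (hEe i).symm)
      rw [this]
      exact hmin E hE hEm) s
  simp only [merge_apply_left hu hv huv, Finsupp.comapDomain_apply, zero_add] at key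
  have hsplit : (∑ i, if i < s then D (u i) + D (v i) else 0) =
      (∑ i, if i < s then D (u i) else 0) + ∑ i, if i < s then D (v i) else 0 := by
    rw [← Finset.sum_add_distrib]
    refine Finset.sum_congr rfl fun i _ => ?_
    split_ifs <;> rfl
  omega

end Shear

section Action

open Function

variable {K : Type*} [Field K] {m n t : ℕ}

/-- The variables `Y_{ik}` (left summand) and `Z_{kj}` (right summand). -/
abbrev Var (m n t : ℕ) : Type := (Fin m × Fin t) ⊕ (Fin t × Fin n)

/-- The values of `σ_g` on the variables. -/
noncomputable abbrev act (m n : ℕ) (g : GL (Fin t) K) : Var m n t → MvPolynomial (Var m n t) K :=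
  Sum.elim
    (fun p : Fin m × Fin t =>
      ∑ l : Fin t, X (Sum.inl (p.1, l)) * C ((g : Matrix (Fin t) (Fin t) K) l p.2))
    (fun p : Fin t × Fin n =>
      ∑ l : Fin t, C (((g⁻¹ : GL (Fin t) K) : Matrix (Fin t) (Fin t) K) p.1 l) *
        X (Sum.inr (l, p.2)))

/-- The transvection `1 + c E_{ab}` as an element of `GL_t`. -/
def transvectionGL {a b : Fin t} (h : a ≠ b) (c : K) : GL (Fin t) K where
  val := Matrix.transvection a b c
  inv := Matrix.transvection a b (-c)
  val_inv := by rw [Matrix.transvection_mul_transvection_same _ _ h, add_neg_cancel,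
    Matrix.transvection_zero]
  inv_val := by rw [Matrix.transvection_mul_transvection_same _ _ h, neg_add_cancel,
    Matrix.transvection_zero]

theorem act_transvectionGL_inl {a b : Fin t} (h : a ≠ b) (c : K) (i : Fin m) (l : Fin t) :
    act m n (transvectionGL h c) (Sum.inl (i, l)) =
      X (Sum.inl (i, l)) + if l = b then C c * X (Sum.inl (i, a)) else 0 := by
  have h1 : ((transvectionGL h c : GL (Fin t) K) : Matrix (Fin t) (Fin t) K) =
    Matrix.transvection a b c := rfl
  simp only [act, Sum.elim_inl, h1, Matrix.transvection, Matrix.add_apply, C_add, mul_add,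
    Finset.sum_add_distrib]
  congr 1
  · rw [Finset.sum_eq_single l] <;> simp +contextual
  · rw [Finset.sum_eq_single a]
    · by_cases hl : l = b
      · simp [hl, mul_comm]
      · simp [hl, Ne.symm hl]
    · intro x _ hx
      simp [hx.symm]
    · simp

theorem act_transvectionGL_inr {a b : Fin t} (h : a ≠ b) (c : K) (l : Fin t) (j : Fin n) :
    act m n (transvectionGL h c) (Sum.inr (l, j)) =
      X (Sum.inr (l, j)) + if l = a then C (-c) * X (Sum.inr (b, j)) else 0 := by
  have h1 : (((transvectionGL h c)⁻¹ : GL (Fin t) K) : Matrix (Fin t) (Fin t) K) =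
    Matrix.transvection a b (-c) := rfl
  simp only [act, Sum.elim_inr, h1, Matrix.transvection, Matrix.add_apply, C_add, add_mul,
    Finset.sum_add_distrib]
  congr 1
  · rw [Finset.sum_eq_single l] <;> simp +contextual [eq_comm]
  · rw [Finset.sum_eq_single b]
    · by_cases hl : l = a
      · simp [hl]
      · simp [hl, Ne.symm hl]
    · intro x _ hx
      simp [hx.symm]
    · simp

/-- The diagonal matrix with entries `d` as an element of `GL_t`. -/
def diagonalGL (d : Fin t → Kˣ) : GL (Fin t) K where
  val := Matrix.diagonal fun l => (d l : K)
  inv := Matrix.diagonal fun l => ((d l)⁻¹ : K)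
  val_inv := by simp
  inv_val := by simp

theorem act_diagonalGL (d : Fin t → Kˣ) :
    act m n (diagonalGL d) =
      fun s => C (Sum.elim (fun p => (d p.2 : K)) (fun p => ((d p.1)⁻¹ : K)) s) * X s := by
  have h1 : ((diagonalGL d : GL (Fin t) K) : Matrix (Fin t) (Fin t) K) =
    Matrix.diagonal fun l => (d l : K) := rfl
  have h2 : (((diagonalGL d)⁻¹ : GL (Fin t) K) : Matrix (Fin t) (Fin t) K) =
    Matrix.diagonal fun l => ((d l)⁻¹ : K) := rfl
  funext s
  rcases s with ⟨i, l⟩ | ⟨l, j⟩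
  · simp only [act, Sum.elim_inl, h1]
    rw [Finset.sum_eq_single l] <;> simp +contextual [mul_comm]
  · simp only [act, Sum.elim_inr, h2]
    rw [Finset.sum_eq_single l] <;> simp +contextual [eq_comm]

theorem coeff_aeval_C_mul_X {σ : Type*} (a : σ → K) (f : MvPolynomial σ K) (e : σ →₀ ℕ) :
    coeff e (aeval (fun s => C (a s) * X s) f) = (e.prod fun s k => a s ^ k) * coeff e f := by
  classical
  conv_lhs => rw [f.as_sum]
  conv_rhs => rw [f.as_sum]
  rw [map_sum, coeff_sum, coeff_sum, Finset.mul_sum]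
  refine Finset.sum_congr rfl fun d _ => ?_
  have h : (d.prod fun s k => (C (a s) * X s : MvPolynomial σ K) ^ k) =
      monomial d (d.prod fun s k => a s ^ k) := by
    rw [monomial_eq, Finsupp.prod, Finsupp.prod, Finsupp.prod, map_prod, ← Finset.prod_mul_distrib]
    simp [mul_pow]
  rw [aeval_monomial, h, algebraMap_eq, C_mul_monomial, coeff_monomial, coeff_monomial]
  split_ifs with hd
  · rw [hd, mul_comm]
  · simp

theorem eq_of_forall_pow_eq_pow [Infinite K] {a b : ℕ} (h : ∀ x : K, x ≠ 0 → x ^ a = x ^ b) :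
    a = b := by
  have : (Polynomial.X ^ (a + 1) : Polynomial K) = Polynomial.X ^ (b + 1) := by
    refine Polynomial.funext fun x => ?_
    by_cases hx : x = 0
    · simp [hx]
    · simp [pow_succ, h x hx]
  simpa using congrArg Polynomial.natDegree this

/-- The exponents of an invariant have the same degree in `Y_{·k}` and in `Z_{k·}`. -/
theorem sum_inl_eq_sum_inr [Infinite K] {f : MvPolynomial (Var m n t) K}
    (hf : ∀ g : GL (Fin t) K, aeval (act m n g) f = f) {e : Var m n t →₀ ℕ} (he : e ∈ f.support)
    (k : Fin t) : ∑ i, e (Sum.inl (i, k)) = ∑ j, e (Sum.inr (k, j)) := by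
  refine eq_of_forall_pow_eq_pow (K := K) fun x hx => ?_
  have h := congrArg (coeff e) (hf (diagonalGL (update 1 k (Units.mk0 x hx))))
  rw [act_diagonalGL, coeff_aeval_C_mul_X, mul_eq_right₀ (mem_support_iff.1 he),
    Finsupp.prod_fintype _ _ (by simp), Fintype.prod_sum_type, Fintype.prod_prod_type,
    Fintype.prod_prod_type, Finset.prod_comm] at h
  simp only [Sum.elim_inl, Sum.elim_inr, Finset.prod_pow_eq_pow_sum] at h
  rw [Finset.prod_eq_single k (fun l _ hl => by simp [hl]) (by simp),
    Finset.prod_eq_single k (fun l _ hl => by simp [hl]) (by simp)] at h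
  simp only [update_self, Units.val_mk0, inv_pow] at h
  rwa [mul_inv_eq_one₀ (pow_ne_zero _ hx)] at h

/-- The weight `∑ (t - k) deg_{Y_{·k}}`. -/
noncomputable def yWeight (m n t : ℕ) : (Var m n t →₀ ℕ) →+ ℕ :=
  Finsupp.weight (Sum.elim (fun p => t - p.2) 0)

/-- The weight `∑ (t - k) deg_{Z_{k·}}`. -/
noncomputable def zWeight (m n t : ℕ) : (Var m n t →₀ ℕ) →+ ℕ :=
  Finsupp.weight (Sum.elim 0 (fun p => t - p.1))

theorem yWeight_apply (e : Var m n t →₀ ℕ) :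
    yWeight m n t e = ∑ k : Fin t, (∑ i, e (Sum.inl (i, k))) * (t - k) := by
  rw [yWeight, Finsupp.weight_apply, Finsupp.sum_fintype _ _ (by simp), Fintype.sum_sum_type,
    Fintype.sum_prod_type, Finset.sum_comm]
  simp [Finset.sum_mul]

theorem zWeight_apply (e : Var m n t →₀ ℕ) :
    zWeight m n t e = ∑ k : Fin t, (∑ j, e (Sum.inr (k, j))) * (t - k) := by
  rw [zWeight, Finsupp.weight_apply, Finsupp.sum_fintype _ _ (by simp), Fintype.sum_sum_type,
    Fintype.sum_prod_type, Fintype.sum_prod_type]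
  simp [Finset.sum_mul]

/-- The monomial order: first the weight, then the exponents of `Y` and then those of `Z`, both
lexicographically. -/
noncomputable def order (m n t : ℕ) : (Var m n t →₀ ℕ) →+
    ℕ ×ₗ (Lex (Fin m ×ₗ Fin t → ℕ)) ×ₗ Lex (Fin t ×ₗ Fin n → ℕ) where
  toFun e := toLex (yWeight m n t e, toLex (toLex fun p => e (Sum.inl (ofLex p)),
    toLex fun p => e (Sum.inr (ofLex p))))
  map_zero' := by rw [map_zero]; rfl
  map_add' e e' := by rw [map_add]; rfl

theorem yWeight_le_of_order_le {e e' : Var m n t →₀ ℕ} (h : order m n t e ≤ order m n t e') :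
    yWeight m n t e ≤ yWeight m n t e' :=
  Prod.Lex.monotone_fst _ _ h

theorem order_lt_of_inl {e e' : Var m n t →₀ ℕ} (hw : yWeight m n t e ≤ yWeight m n t e')
    (h : (toLex fun p : Fin m ×ₗ Fin t => e (Sum.inl (ofLex p))) <
      toLex fun p : Fin m ×ₗ Fin t => e' (Sum.inl (ofLex p))) :
    order m n t e < order m n t e' := by
  rcases hw.lt_or_eq with hw | hw
  · exact Prod.Lex.toLex_lt_toLex.2 (Or.inl hw)
  · exact Prod.Lex.toLex_lt_toLex.2 (Or.inr ⟨hw, Prod.Lex.toLex_lt_toLex.2 (Or.inl h)⟩)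

theorem order_lt_of_inr {e e' : Var m n t →₀ ℕ} (he : ∀ p, e (Sum.inl p) = e' (Sum.inl p))
    (h : (toLex fun p : Fin t ×ₗ Fin n => e (Sum.inr (ofLex p))) <
      toLex fun p : Fin t ×ₗ Fin n => e' (Sum.inr (ofLex p))) :
    order m n t e < order m n t e' :=
  Prod.Lex.toLex_lt_toLex.2 (Or.inr ⟨by simp [yWeight_apply, he],
    Prod.Lex.toLex_lt_toLex.2 (Or.inr ⟨by simp [he], h⟩)⟩)

theorem leadCongr_shear_inl {k k' : Fin t} (h : k < k') (c : K) (s : Var m n t) :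
    LeadCongr (zWeight m n t) (zWeight m n t (Finsupp.single s 1))
      (act m n (transvectionGL h.ne c) s)
      (shear (fun i => Sum.inl (i, k)) (fun i => Sum.inl (i, k')) c s) := by
  have hv : Injective fun i : Fin m => (Sum.inl (i, k') : Var m n t) := fun i j hij => by
    simpa using hij
  rcases s with ⟨i, l⟩ | ⟨l, j⟩
  · have heq : act m n (transvectionGL h.ne c) (Sum.inl (i, l)) =
        shear (fun i => Sum.inl (i, k)) (fun i => Sum.inl (i, k')) c (Sum.inl (i, l)) := by
      rw [act_transvectionGL_inl]
      by_cases hl : l = k'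
      · subst hl
        rw [shear, hv.extend_apply]
        simp
      · rw [shear, extend_apply' _ _ _ (by simpa using Ne.symm hl)]
        simp [hl]
    rw [heq]
    refine .of_right ?_ (by simp)
    rw [← heq, act_transvectionGL_inl]
    refine add_mem (X_mem_lowerEqPart _ _) ?_
    split_ifs
    · rw [X, C_mul_monomial]
      exact (monomial_mem_restrictSupport K).2 (Or.inl (by simp [zWeight, Finsupp.weight_single]))
    · exact zero_mem _
  · rw [act_transvectionGL_inr, shear, extend_apply' _ _ _ (by simp)]
    refine .of_right (X_mem_lowerEqPart _ _) ?_
    rw [add_sub_cancel_left]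
    split_ifs with hl
    · rw [X, C_mul_monomial]
      refine (monomial_mem_restrictSupport K).2 (Or.inl ?_)
      simp only [zWeight, Set.mem_ofPred_eq, Finsupp.weight_single, Sum.elim_inr, hl, smul_eq_mul]
      omega
    · exact zero_mem _

theorem leadCongr_shear_inr {k k' : Fin t} (h : k < k') (c : K) (s : Var m n t) :
    LeadCongr (yWeight m n t) (yWeight m n t (Finsupp.single s 1))
      (act m n (transvectionGL h.ne' (-c)) s)
      (shear (fun j => Sum.inr (k, j)) (fun j => Sum.inr (k', j)) c s) := by
  have hv : Injective fun j : Fin n => (Sum.inr (k', j) : Var m n t) := fun i j hij => by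
    simpa using hij
  rcases s with ⟨i, l⟩ | ⟨l, j⟩
  · rw [act_transvectionGL_inl, shear, extend_apply' _ _ _ (by simp)]
    refine .of_right (X_mem_lowerEqPart _ _) ?_
    rw [add_sub_cancel_left]
    split_ifs with hl
    · rw [X, C_mul_monomial]
      refine (monomial_mem_restrictSupport K).2 (Or.inl ?_)
      simp only [yWeight, Set.mem_ofPred_eq, Finsupp.weight_single, Sum.elim_inl, hl, smul_eq_mul]
      omega
    · exact zero_mem _
  · have heq : act m n (transvectionGL h.ne' (-c)) (Sum.inr (l, j)) =
        shear (fun j => Sum.inr (k, j)) (fun j => Sum.inr (k', j)) c (Sum.inr (l, j)) := by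
      rw [act_transvectionGL_inr, neg_neg]
      by_cases hl : l = k'
      · subst hl
        rw [shear, hv.extend_apply]
        simp
      · rw [shear, extend_apply' _ _ _ (by simpa using Ne.symm hl)]
        simp [hl]
    rw [heq]
    refine .of_right ?_ (by simp)
    rw [← heq, act_transvectionGL_inr]
    refine add_mem (X_mem_lowerEqPart _ _) ?_
    split_ifs
    · rw [X, C_mul_monomial]
      exact (monomial_mem_restrictSupport K).2 (Or.inl (by simp [yWeight, Finsupp.weight_single]))
    · exact zero_mem _

/-- `A` counts the entries of the columns of a Young tableau with strictly increasing rows: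
for `k < k'`, the number of entries at most `s` in column `k'` is bounded by the number of entries
less than `s` in column `k`. -/
def IsTableau {p t : ℕ} (A : Fin t → Fin p → ℕ) : Prop :=
  ∀ k k', k < k' → ∀ s, (∑ i, if i ≤ s then A k' i else 0) ≤ ∑ i, if i < s then A k i else 0

/-- The exponents that describe a pair of tableaux of the same shape. -/
structure IsStandard (D : Var m n t →₀ ℕ) : Prop where
  balanced : ∀ k, ∑ i, D (Sum.inl (i, k)) = ∑ j, D (Sum.inr (k, j))
  left : IsTableau fun k i => D (Sum.inl (i, k))
  right : IsTableau fun k j => D (Sum.inr (k, j))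

theorem isStandard_of_invariant [Infinite K] {f : MvPolynomial (Var m n t) K}
    (hf : ∀ g : GL (Fin t) K, aeval (act m n g) f = f) {D : Var m n t →₀ ℕ} (hD : D ∈ f.support)
    (hmax : ∀ e ∈ f.support, order m n t e ≤ order m n t D) : IsStandard D := by
  have hbal : ∀ e ∈ f.support, zWeight m n t e = yWeight m n t e := fun e he => by
    simp only [zWeight_apply, yWeight_apply, sum_inl_eq_sum_inr hf he]
  refine ⟨fun k => sum_inl_eq_sum_inr hf hD k, fun k k' h => ?_, fun k k' h => ?_⟩
  · have hu : Injective fun i : Fin m => (Sum.inl (i, k) : Var m n t) := fun i j hij => by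
      simpa using hij
    have hv : Injective fun i : Fin m => (Sum.inl (i, k') : Var m n t) := fun i j hij => by
      simpa using hij
    have huv : ∀ i j : Fin m, (Sum.inl (i, k) : Var m n t) ≠ Sum.inl (j, k') := fun i j => by
      simp [h.ne]
    refine sum_le_sum_of_shear_invariant hu hv huv (ω := zWeight m n t)
      (by simp [zWeight, Finsupp.weight_single]) (by simp [zWeight, Finsupp.weight_single])
      (leadCongr_shear_inl h) (fun c => hf _) hD (fun e he => ?_) (fun e he hm => ?_)
    · rw [hbal e he, hbal D hD]
      exact yWeight_le_of_order_le (hmax e he)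
    · have hother : ∀ s, (¬∃ i, Sum.inl (i, k') = s) → (¬∃ i, Sum.inl (i, k) = s) →
          e s = D s := fun s hs hs' => by
        simpa only [merge_apply_of_notMem hv _ hs hs'] using DFunLike.congr_fun hm s
      have hsum : ∀ i, e (Sum.inl (i, k)) + e (Sum.inl (i, k')) =
          D (Sum.inl (i, k)) + D (Sum.inl (i, k')) := fun i => by
        simpa only [merge_apply_left hu hv huv] using DFunLike.congr_fun hm (Sum.inl (i, k))
      refine not_lt.1 fun hlt => absurd (hmax e he) (not_le.2 ?_)
      obtain ⟨i, hi, hlt⟩ := hlt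
      refine order_lt_of_inl (le_of_eq ?_) ⟨toLex (i, k), fun p hp => ?_, ?_⟩
      · rw [← hbal e he, ← hbal D hD, zWeight_apply, zWeight_apply]
        simp only [hother (Sum.inr _) (by simp) (by simp)]
      · obtain ⟨⟨i', l⟩, rfl⟩ := toLex.surjective p
        rw [Prod.Lex.toLex_lt_toLex] at hp
        change D (Sum.inl (i', l)) = e (Sum.inl (i', l))
        rcases hp with hp | ⟨rfl, hp⟩
        · have h1 : e (Sum.inl (i', k')) = D (Sum.inl (i', k')) := hi i' hp
          have h2 := hsum i'
          by_cases hl : l = k'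
          · rw [hl, h1]
          by_cases hl' : l = k
          · rw [hl']; omega
          · exact (hother _ (by simp [Ne.symm hl]) (by simp [Ne.symm hl'])).symm
        · have hp : l < k := hp
          exact (hother _ (by simp [(hp.trans h).ne']) (by simp [hp.ne'])).symm
      · change D (Sum.inl (i, k)) < e (Sum.inl (i, k))
        have h1 : e (Sum.inl (i, k')) < D (Sum.inl (i, k')) := hlt
        have h2 := hsum i
        omega
  · have hu : Injective fun j : Fin n => (Sum.inr (k, j) : Var m n t) := fun i j hij => by
      simpa using hij
    have hv : Injective fun j : Fin n => (Sum.inr (k', j) : Var m n t) := fun i j hij => by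
      simpa using hij
    have huv : ∀ i j : Fin n, (Sum.inr (k, i) : Var m n t) ≠ Sum.inr (k', j) := fun i j => by
      simp [h.ne]
    refine sum_le_sum_of_shear_invariant hu hv huv (ω := yWeight m n t)
      (by simp [yWeight, Finsupp.weight_single]) (by simp [yWeight, Finsupp.weight_single])
      (leadCongr_shear_inr h) (fun c => hf _) hD
      (fun e he => yWeight_le_of_order_le (hmax e he)) (fun e he hm => ?_)
    have hother : ∀ s, (¬∃ j, Sum.inr (k', j) = s) → (¬∃ j, Sum.inr (k, j) = s) →
        e s = D s := fun s hs hs' => by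
      simpa only [merge_apply_of_notMem hv _ hs hs'] using DFunLike.congr_fun hm s
    have hsum : ∀ j, e (Sum.inr (k, j)) + e (Sum.inr (k', j)) =
        D (Sum.inr (k, j)) + D (Sum.inr (k', j)) := fun j => by
      simpa only [merge_apply_left hu hv huv] using DFunLike.congr_fun hm (Sum.inr (k, j))
    refine not_lt.1 fun hlt => absurd (hmax e he) (not_le.2 ?_)
    obtain ⟨j, hj, hlt⟩ := hlt
    refine order_lt_of_inr (fun p => (hother _ (by simp) (by simp)).symm)
      ⟨toLex (k, j), fun p hp => ?_, ?_⟩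
    · obtain ⟨⟨l, j'⟩, rfl⟩ := toLex.surjective p
      rw [Prod.Lex.toLex_lt_toLex] at hp
      change D (Sum.inr (l, j')) = e (Sum.inr (l, j'))
      rcases hp with hp | ⟨hl, hp⟩
      · have hp : l < k := hp
        exact (hother _ (by simp [(hp.trans h).ne']) (by simp [hp.ne'])).symm
      · have hl : l = k := hl
        have h1 : e (Sum.inr (k', j')) = D (Sum.inr (k', j')) := hj j' hp
        have h2 := hsum j'
        rw [hl]
        omega
    · change D (Sum.inr (k, j)) < e (Sum.inr (k, j))
      have h1 : e (Sum.inr (k', j)) < D (Sum.inr (k', j)) := hlt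
      have h2 := hsum j
      omega

end Action

section Minor

open Function

theorem toLex_count_lt {α β : Type*} [LinearOrder α] [LinearOrder β] {r : ℕ} {x : Fin r → α}
    (hx : StrictMono x) {y y' : Fin r → β} {a₀ : Fin r} (heq : ∀ a < a₀, y' a = y a)
    (hlt : y a₀ < y' a₀) :
    (toLex fun p : α ×ₗ β => ∑ a, if (x a, y' a) = ofLex p then (1 : ℕ) else 0) <
      toLex fun p : α ×ₗ β => ∑ a, if (x a, y a) = ofLex p then (1 : ℕ) else 0 := by
  refine ⟨toLex (x a₀, y a₀), fun p hp => ?_, ?_⟩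
  · obtain ⟨⟨u, v⟩, rfl⟩ := toLex.surjective p
    rw [Prod.Lex.toLex_lt_toLex] at hp
    change (∑ a, if (x a, y' a) = (u, v) then 1 else 0) = ∑ a, if (x a, y a) = (u, v) then 1 else 0
    refine Finset.sum_congr rfl fun a _ => ?_
    rcases lt_trichotomy a a₀ with ha | rfl | ha
    · rw [heq a ha]
    · grind
    · have := hx ha
      grind
  · refine Finset.sum_lt_sum (fun a _ => ?_) ⟨a₀, Finset.mem_univ _, ?_⟩
    · rcases eq_or_ne a a₀ with rfl | ha
      · simp [hlt.ne']
      · simp [hx.injective.ne ha]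
    · simp [hlt.ne']

theorem exists_first_ne_castLE {r t : ℕ} (h : r ≤ t) {φ : Fin r → Fin t} (hφ : Injective φ)
    (hne : φ ≠ Fin.castLE h) :
    ∃ a₀, (∀ a < a₀, φ a = Fin.castLE h a) ∧ Fin.castLE h a₀ < φ a₀ := by
  obtain ⟨a₁, h₁⟩ := Function.ne_iff.1 hne
  obtain ⟨a₀, h₀, hmin⟩ := WellFounded.has_min (wellFounded_lt (α := Fin r))
    {a | φ a ≠ Fin.castLE h a} ⟨a₁, h₁⟩
  have heq : ∀ a < a₀, φ a = Fin.castLE h a := fun a ha => by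
    by_contra hc
    exact hmin a hc ha
  refine ⟨a₀, heq, lt_of_le_of_ne (not_lt.1 fun hlt => ?_) (Ne.symm h₀)⟩
  have hlt' : (φ a₀ : ℕ) < a₀ := hlt
  let b : Fin r := ⟨φ a₀, hlt'.trans a₀.2⟩
  have hb : b < a₀ := hlt'
  exact hb.ne (hφ (heq b hb))

theorem sum_range_card_le_sum (S : Finset ℕ) : ∑ i ∈ Finset.range S.card, i ≤ ∑ x ∈ S, x := by
  induction S using Finset.induction_on_max with
  | empty => simp
  | insert a s hs ih =>
    have ha : a ∉ s := fun h => (hs a h).false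
    have hcard : s.card ≤ a := by
      simpa using Finset.card_le_card (t := Finset.range a) fun x hx =>
        Finset.mem_range.2 (hs x hx)
    rw [Finset.card_insert_of_notMem ha, Finset.sum_range_succ, Finset.sum_insert ha]
    omega

theorem sum_val_le_sum_of_injective {r t : ℕ} {φ : Fin r → Fin t} (hφ : Injective φ) :
    ∑ a : Fin r, (a : ℕ) ≤ ∑ a, (φ a : ℕ) := by
  have hinj : Injective fun a => (φ a : ℕ) := Fin.val_injective.comp hφ
  have h := sum_range_card_le_sum (Finset.univ.image fun a => (φ a : ℕ))
  rw [Finset.card_image_of_injective _ hinj, Finset.sum_image hinj.injOn] at h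
  simpa [Fin.sum_univ_eq_sum_range fun i => i] using h

variable {m n t r : ℕ}

/-- The exponent of `∏ₐ Y_{I a, φ a} Z_{φ a, J a}`. -/
noncomputable def minorExp (I : Fin r → Fin m) (φ : Fin r → Fin t) (J : Fin r → Fin n) :
    Var m n t →₀ ℕ :=
  ∑ a, (Finsupp.single (Sum.inl (I a, φ a)) 1 + Finsupp.single (Sum.inr (φ a, J a)) 1)

theorem minorExp_inl (I : Fin r → Fin m) (φ : Fin r → Fin t) (J : Fin r → Fin n)
    (p : Fin m × Fin t) :
    minorExp I φ J (Sum.inl p) = ∑ a, if (I a, φ a) = p then 1 else 0 := by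
  simp [minorExp, Finsupp.finsetSum_apply, Finsupp.single_apply]

theorem minorExp_inr (I : Fin r → Fin m) (φ : Fin r → Fin t) (J : Fin r → Fin n)
    (p : Fin t × Fin n) :
    minorExp I φ J (Sum.inr p) = ∑ a, if (φ a, J a) = p then 1 else 0 := by
  simp [minorExp, Finsupp.finsetSum_apply, Finsupp.single_apply]

theorem monomial_minorExp (K : Type*) [CommRing K] (I : Fin r → Fin m) (φ : Fin r → Fin t)
    (J : Fin r → Fin n) :
    monomial (minorExp I φ J) (1 : K) =
      (∏ a, X (Sum.inl (I a, φ a))) * ∏ a, X (Sum.inr (φ a, J a)) := by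
  rw [minorExp, monomial_sum_one, ← Finset.prod_mul_distrib]
  simp [X, monomial_mul]

theorem yWeight_minorExp (I : Fin r → Fin m) (φ : Fin r → Fin t) (J : Fin r → Fin n) :
    yWeight m n t (minorExp I φ J) = ∑ a, (t - φ a) := by
  simp [yWeight, minorExp, Finsupp.weight_single]

theorem order_minorExp_lt_of_ne (h : r ≤ t) {I : Fin r → Fin m} (hI : StrictMono I)
    {φ : Fin r → Fin t} (hφ : Injective φ) (hne : φ ≠ Fin.castLE h) (J J' : Fin r → Fin n) :
    order m n t (minorExp I φ J') < order m n t (minorExp I (Fin.castLE h) J) := by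
  refine order_lt_of_inl ?_ ?_
  · have h1 := sum_val_le_sum_of_injective hφ
    have h2 : ∀ ψ : Fin r → Fin t, ∑ a, (t - ψ a) + ∑ a, (ψ a : ℕ) = ∑ _a : Fin r, t := fun ψ => by
      rw [← Finset.sum_add_distrib]
      exact Finset.sum_congr rfl fun a _ => Nat.sub_add_cancel (ψ a).2.le
    have h3 := h2 φ
    have h4 := h2 (Fin.castLE h)
    simp only [Fin.val_castLE] at h4
    simp only [yWeight_minorExp, Fin.val_castLE]
    omega
  · obtain ⟨a₀, heq, hlt⟩ := exists_first_ne_castLE h hφ hne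
    simpa only [minorExp_inl] using toLex_count_lt hI heq hlt

theorem order_minorExp_comp_perm_lt (h : r ≤ t) (I : Fin r → Fin m) {J : Fin r → Fin n}
    (hJ : StrictMono J) {ρ : Equiv.Perm (Fin r)} (hne : ρ ≠ 1) :
    order m n t (minorExp I (Fin.castLE h) (J ∘ ρ)) <
      order m n t (minorExp I (Fin.castLE h) J) := by
  obtain ⟨a₀, heq, hlt⟩ := exists_first_ne_castLE le_rfl ρ.injective
    fun hc => hne (Equiv.ext fun a => congrFun hc a)
  refine order_lt_of_inr (fun p => by simp only [minorExp_inl]) ?_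
  simpa only [minorExp_inr] using toLex_count_lt (y := J) (y' := J ∘ ρ)
    (Fin.strictMono_castLE h) (fun a ha => congrArg J (heq a ha)) (hJ hlt)

/-- The values of `θ*` on the variables. -/
noncomputable abbrev mulVar (K : Type*) [CommRing K] (m n t : ℕ) (p : Fin m × Fin n) :
    MvPolynomial (Var m n t) K :=
  ∑ k : Fin t, X (Sum.inl (p.1, k)) * X (Sum.inr (k, p.2))

variable {K : Type*} [CommRing K]

theorem aeval_mulVar_det (I : Fin r → Fin m) (J : Fin r → Fin n) :
    aeval (mulVar K m n t) (Matrix.of fun a b => (X (I a, J b) : MvPolynomial _ K)).det =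
      ∑ φ : Fin r → Fin t, (∏ a, X (Sum.inl (I a, φ a))) *
        (Matrix.of fun a b => (X (Sum.inr (φ a, J b)) : MvPolynomial (Var m n t) K)).det := by
  rw [AlgHom.map_det]
  have h := MultilinearMap.map_sum
    (Matrix.detRowAlternating (n := Fin r) (R := MvPolynomial (Var m n t) K)).toMultilinearMap
    (fun (a : Fin r) (k : Fin t) => (X (Sum.inl (I a, k)) : MvPolynomial (Var m n t) K) •
      fun b => (X (Sum.inr (k, J b)) : MvPolynomial (Var m n t) K))
  simp only [MultilinearMap.map_smul_univ] at h
  refine Eq.trans (congrArg Matrix.det ?_) h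
  ext1 a b
  simp [Finset.sum_apply]

theorem prod_mul_det_eq_sum (I : Fin r → Fin m) (φ : Fin r → Fin t) (J : Fin r → Fin n) :
    (∏ a, X (Sum.inl (I a, φ a))) *
        (Matrix.of fun a b => (X (Sum.inr (φ a, J b)) : MvPolynomial (Var m n t) K)).det =
      ∑ ρ : Equiv.Perm (Fin r),
        ((Equiv.Perm.sign ρ : ℤ) : K) • monomial (minorExp I φ (J ∘ ρ)) 1 := by
  rw [← Matrix.det_transpose, Matrix.det_apply', Finset.mul_sum]
  refine Finset.sum_congr rfl fun ρ _ => ?_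
  rw [monomial_minorExp, Algebra.smul_def, map_intCast]
  simp only [Matrix.transpose_apply, Matrix.of_apply, Function.comp_apply]
  ring

theorem aeval_mulVar_det_sub_mem (h : r ≤ t) {I : Fin r → Fin m} (hI : StrictMono I)
    {J : Fin r → Fin n} (hJ : StrictMono J) :
    aeval (mulVar K m n t) (Matrix.of fun a b => (X (I a, J b) : MvPolynomial _ K)).det -
        monomial (minorExp I (Fin.castLE h) J) 1 ∈
      lowerPart K (order m n t) (order m n t (minorExp I (Fin.castLE h) J)) := by
  rw [aeval_mulVar_det, ← Finset.add_sum_erase _ _ (Finset.mem_univ (Fin.castLE h)),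
    add_sub_right_comm]
  refine add_mem ?_ (sum_mem fun φ hφ => ?_)
  · rw [prod_mul_det_eq_sum, ← Finset.add_sum_erase _ _ (Finset.mem_univ 1)]
    simp only [Equiv.Perm.sign_one, Units.val_one, Int.cast_one, one_smul, Equiv.Perm.coe_one,
      Function.comp_id, add_sub_cancel_left]
    exact sum_mem fun ρ hρ => Submodule.smul_mem _ _ ((monomial_mem_restrictSupport K).2
      (Or.inl (order_minorExp_comp_perm_lt h I hJ (Finset.ne_of_mem_erase hρ))))
  · by_cases hinj : Injective φ
    · rw [prod_mul_det_eq_sum]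
      exact sum_mem fun ρ _ => Submodule.smul_mem _ _ ((monomial_mem_restrictSupport K).2
        (Or.inl (order_minorExp_lt_of_ne h hI hinj (Finset.ne_of_mem_erase hφ) J _)))
    · obtain ⟨a, b, hab, hne⟩ : ∃ a b, φ a = φ b ∧ a ≠ b := by
        simpa [Injective] using hinj
      rw [Matrix.det_zero_of_row_eq hne (by ext1; simp [hab]), mul_zero]
      exact zero_mem _

end Minor

section Peel

theorem exists_iff_lt_of_lower {t : ℕ} {P : Fin t → Prop} (hP : ∀ k k', k < k' → P k' → P k) :
    ∃ r ≤ t, ∀ k : Fin t, P k ↔ (k : ℕ) < r := by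
  by_cases hall : ∀ k, P k
  · exact ⟨t, le_rfl, fun k => iff_of_true (hall k) k.2⟩
  · push Not at hall
    obtain ⟨k₀, h₀, hmin⟩ := WellFounded.has_min (wellFounded_lt (α := Fin t)) {k | ¬P k} hall
    refine ⟨k₀, k₀.2.le, fun k => ⟨fun hk => ?_, fun hk => ?_⟩⟩
    · by_contra hc
      rcases (not_lt.1 hc : k₀ ≤ k).eq_or_lt with rfl | hlt
      · exact h₀ hk
      · exact h₀ (hP _ _ hlt hk)
    · by_contra hc
      exact hmin k hc hk

theorem IsTableau.exists_pos_of_lt {p t : ℕ} {A : Fin t → Fin p → ℕ} (hA : IsTableau A)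
    {k k' : Fin t} (h : k < k') {s : Fin p} (hs : 0 < A k' s) : ∃ i < s, 0 < A k i := by
  have h1 : A k' s ≤ ∑ i, if i ≤ s then A k' i else 0 := by
    simpa using Finset.single_le_sum (f := fun i => if i ≤ s then A k' i else 0)
      (fun _ _ => Nat.zero_le _) (Finset.mem_univ s)
  have h2 := (hs.trans_le h1).trans_le (hA k k' h s)
  obtain ⟨i, -, hi⟩ := Finset.exists_ne_zero_of_sum_ne_zero h2.ne'
  have his : i < s := by
    by_contra hc
    exact hi (if_neg hc)
  exact ⟨i, his, Nat.pos_of_ne_zero (by simpa [his] using hi)⟩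

theorem sum_ite_add_ite {p : ℕ} (B : Fin p → ℕ) (q : Fin p → Prop) [DecidablePred q] (j : Fin p) :
    (∑ i, if q i then B i + (if j = i then 1 else 0) else 0) =
      (∑ i, if q i then B i else 0) + if q j then 1 else 0 := by
  have h : ∀ i, (if q i then B i + (if j = i then 1 else 0) else 0) =
      (if q i then B i else 0) + if j = i then (if q i then 1 else 0) else 0 := fun i => by
    split_ifs <;> rfl
  simp only [h, Finset.sum_add_distrib, Finset.sum_ite_eq, Finset.mem_univ, if_true]

/-- Removing the first row of a tableau. -/
theorem IsTableau.exists_row {p t r : ℕ} {A : Fin t → Fin p → ℕ} (hA : IsTableau A) (hr : r ≤ t)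
    (hcol : ∀ k : Fin t, (∃ i, 0 < A k i) ↔ (k : ℕ) < r) :
    ∃ (I : Fin r → Fin p) (A' : Fin t → Fin p → ℕ), StrictMono I ∧ IsTableau A' ∧
      ∀ k i, A k i = (∑ a, if (Fin.castLE hr a, I a) = (k, i) then 1 else 0) + A' k i := by
  have hmin : ∀ a : Fin r, ∃ i, 0 < A (Fin.castLE hr a) i ∧
      ∀ j < i, A (Fin.castLE hr a) j = 0 := fun a => by
    obtain ⟨i, hi, hmin⟩ := WellFounded.has_min (wellFounded_lt (α := Fin p))
      {i | 0 < A (Fin.castLE hr a) i} ((hcol _).2 a.2)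
    exact ⟨i, hi, fun j hj => Nat.eq_zero_of_not_pos fun hc => hmin j hc hj⟩
  choose I hpos hzero using hmin
  have hI : StrictMono I := fun a b hab => by
    obtain ⟨i, hi, hi'⟩ := hA.exists_pos_of_lt (Fin.strictMono_castLE hr hab) (hpos b)
    refine lt_of_le_of_lt (not_lt.1 fun hc => ?_) hi
    exact hi'.ne' (hzero a i hc)
  have hc : ∀ (b : Fin r) (i : Fin p),
      (∑ a, if (Fin.castLE hr a, I a) = (Fin.castLE hr b, i) then 1 else 0) =
        if I b = i then 1 else 0 := fun b i => by
    rw [Finset.sum_eq_single b (fun a _ hab => by simp [hab]) (by simp)]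
    simp
  have hempty : ∀ k : Fin t, ¬(k : ℕ) < r → ∀ i, A k i = 0 := fun k hk i =>
    Nat.eq_zero_of_not_pos fun hi => hk ((hcol k).1 ⟨i, hi⟩)
  have hdecomp : ∀ (b : Fin r) i, A (Fin.castLE hr b) i =
      (A (Fin.castLE hr b) i - if I b = i then 1 else 0) + if I b = i then 1 else 0 :=
    fun b i => by
      split_ifs with h
      · have := hpos b
        rw [h] at this
        omega
      · rfl
  refine ⟨I, fun k i => A k i - ∑ a, if (Fin.castLE hr a, I a) = (k, i) then 1 else 0, hI,
    fun k k' hk s => ?_, fun k i => ?_⟩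
  · by_cases hk' : (k' : ℕ) < r
    · obtain ⟨b, rfl⟩ : ∃ b, Fin.castLE hr b = k' := ⟨⟨k', hk'⟩, rfl⟩
      obtain ⟨a, rfl⟩ : ∃ a, Fin.castLE hr a = k :=
        ⟨⟨k, lt_trans (show (k : ℕ) < _ from hk) hk'⟩, rfl⟩
      have hab : a < b := hk
      have h := hA _ _ hk s
      simp only [hc]
      by_cases hs : I b ≤ s
      · simp_rw +singlePass [hdecomp a, hdecomp b] at h
        rw [sum_ite_add_ite, sum_ite_add_ite, if_pos hs, if_pos ((hI hab).trans_le hs)] at h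
        omega
      · refine le_of_eq_of_le (Finset.sum_eq_zero fun i _ => ?_) (Nat.zero_le _)
        refine ite_eq_right_iff.2 fun hi => ?_
        rw [hzero b i (hi.trans_lt (not_le.1 hs)), Nat.zero_sub]
    · refine le_of_eq_of_le (Finset.sum_eq_zero fun i _ => ?_) (Nat.zero_le _)
      simp only [hempty k' hk', Nat.zero_sub, ite_self]
  · by_cases hk : (k : ℕ) < r
    · obtain ⟨b, rfl⟩ : ∃ b, Fin.castLE hr b = k := ⟨⟨k, hk⟩, rfl⟩
      simp only [hc]
      rw [add_comm]
      exact hdecomp b i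
    · have : (∑ a, if (Fin.castLE hr a, I a) = (k, i) then 1 else 0) = 0 :=
        Finset.sum_eq_zero fun a _ => if_neg fun h => hk (by
          rw [← show Fin.castLE hr a = k from (Prod.ext_iff.1 h).1]
          exact a.2)
      simp only [this, hempty k hk]

variable {m n t : ℕ}

theorem IsStandard.exists_minorExp_add {D : Var m n t →₀ ℕ} (hD : IsStandard D) (h0 : D ≠ 0) :
    ∃ (r : ℕ) (hr : r ≤ t) (I : Fin r → Fin m) (J : Fin r → Fin n) (D' : Var m n t →₀ ℕ),
      StrictMono I ∧ StrictMono J ∧ IsStandard D' ∧ D' < D ∧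
        D = minorExp I (Fin.castLE hr) J + D' := by
  obtain ⟨r, hr, hcol⟩ := exists_iff_lt_of_lower (P := fun k => ∃ i, 0 < D (Sum.inl (i, k)))
    fun k k' hk ⟨s, hs⟩ => by
      obtain ⟨i, -, hi⟩ := hD.left.exists_pos_of_lt hk hs
      exact ⟨i, hi⟩
  have hiff : ∀ k, (∃ i, 0 < D (Sum.inl (i, k))) ↔ ∃ j, 0 < D (Sum.inr (k, j)) := fun k => by
    have h1 : 0 < ∑ i, D (Sum.inl (i, k)) ↔ 0 < ∑ j, D (Sum.inr (k, j)) := by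
      rw [hD.balanced k]
    simpa [Finset.sum_pos_iff] using h1
  obtain ⟨I, A, hI, hA, hDA⟩ := hD.left.exists_row hr hcol
  obtain ⟨J, B, hJ, hB, hDB⟩ := hD.right.exists_row hr fun k => (hiff k).symm.trans (hcol k)
  let D' : Var m n t →₀ ℕ := Finsupp.equivFunOnFinite.symm
    (Sum.elim (fun p => A p.2 p.1) fun p => B p.1 p.2)
  have hadd : D = minorExp I (Fin.castLE hr) J + D' := by
    ext s
    rcases s with ⟨i, k⟩ | ⟨k, j⟩
    · rw [Finsupp.add_apply, minorExp_inl]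
      refine (hDA k i).trans ?_
      simp only [D', Finsupp.equivFunOnFinite_symm_apply_apply, Sum.elim_inl, Prod.mk.injEq,
        and_comm]
    · rw [Finsupp.add_apply, minorExp_inr]
      exact hDB k j
  refine ⟨r, hr, I, J, D', hI, hJ, ⟨fun k => ?_, hA, hB⟩, ?_, hadd⟩
  · have h := hD.balanced k
    simp only [hDA, hDB, Finset.sum_add_distrib] at h
    rw [Finset.sum_comm, Finset.sum_comm (s := Finset.univ (α := Fin n))] at h
    simp only [Prod.mk.injEq, ite_and, Finset.sum_ite_irrel, Finset.sum_ite_eq, Finset.mem_univ,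
      if_true, Finset.sum_const_zero] at h
    exact Nat.add_left_cancel h
  · rw [hadd]
    refine lt_add_of_pos_left _ (pos_iff_ne_zero.2 fun hE => h0 ?_)
    have hr0 : ∀ k : Fin t, ¬(k : ℕ) < r := fun k hk => by
      have h1 := DFunLike.congr_fun hE (Sum.inl (I ⟨k, hk⟩, k))
      rw [minorExp_inl] at h1
      simpa using (Finset.sum_eq_zero_iff.1 h1) ⟨k, hk⟩ (Finset.mem_univ _)
    ext s
    rcases s with ⟨i, k⟩ | ⟨k, j⟩
    · exact Nat.eq_zero_of_not_pos fun hi => hr0 k ((hcol k).1 ⟨i, hi⟩)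
    · exact Nat.eq_zero_of_not_pos fun hj => hr0 k ((hcol k).1 ((hiff k).2 ⟨j, hj⟩))

theorem IsStandard.exists_mem_range (K : Type*) [CommRing K] {D : Var m n t →₀ ℕ}
    (hD : IsStandard D) : ∃ q ∈ (aeval (R := K) (mulVar K m n t)).range,
      q - monomial D 1 ∈ lowerPart K (order m n t) (order m n t D) := by
  induction D using WellFoundedLT.induction with
  | ind D ih =>
    by_cases h0 : D = 0
    · exact ⟨1, one_mem _, by simp [h0]⟩
    obtain ⟨r, hr, I, J, D', hI, hJ, hD', hlt, rfl⟩ := hD.exists_minorExp_add h0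
    obtain ⟨q, hq, hq'⟩ := ih D' hlt hD'
    refine ⟨_, mul_mem (AlgHom.mem_range_self _
      (Matrix.of fun a b => (X (I a, J b) : MvPolynomial _ K)).det) hq, ?_⟩
    have h := ((leadCongr_of_sub_mem (aeval_mulVar_det_sub_mem (K := K) hr hI hJ)).mul
      (leadCongr_of_sub_mem hq')).sub
    rwa [monomial_mul, one_mul, ← map_add] at h

end Peel

section Invariants

variable {K : Type*} [Field K] {m n t : ℕ}

theorem order_injective : Function.Injective (order m n t) := fun e e' h => by
  have h1 := congrArg (fun x => (ofLex x).2) h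
  ext s
  rcases s with p | p
  · exact congrFun (congrArg (fun x => (ofLex x).1) h1) (toLex p)
  · exact congrFun (congrArg (fun x => (ofLex x).2) h1) (toLex p)

theorem aeval_act_aeval_mulVar (g : GL (Fin t) K) (p : MvPolynomial (Fin m × Fin n) K) :
    aeval (act m n g) (aeval (mulVar K m n t) p) = aeval (mulVar K m n t) p := by
  rw [← AlgHom.comp_apply, comp_aeval]
  congr 2
  funext ⟨i, j⟩
  let Y : Matrix (Fin m) (Fin t) (MvPolynomial (Var m n t) K) :=
    Matrix.of fun i k => X (Sum.inl (i, k))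
  let Z : Matrix (Fin t) (Fin n) (MvPolynomial (Var m n t) K) :=
    Matrix.of fun k j => X (Sum.inr (k, j))
  let G : GL (Fin t) (MvPolynomial (Var m n t) K) := Matrix.GeneralLinearGroup.map C g
  have h : Y * G.val * (G⁻¹.val * Z) = Y * Z := by
    rw [Matrix.mul_assoc, ← Matrix.mul_assoc _ _ Z, ← Units.val_mul, mul_inv_cancel, Units.val_one,
      Matrix.one_mul]
  have hij := congrFun (congrFun h i) j
  rw [Matrix.mul_apply, Matrix.mul_apply] at hij
  refine Eq.trans ?_ hij
  simp only [map_sum, map_mul, aeval_X, Sum.elim_inl, Sum.elim_inr]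
  rfl

theorem mem_range_of_invariant [Infinite K] {f : MvPolynomial (Var m n t) K}
    (hf : ∀ g : GL (Fin t) K, aeval (act m n g) f = f) :
    f ∈ (aeval (R := K) (mulVar K m n t)).range := by
  obtain ⟨b, hb⟩ := (f.support.image (order m n t)).exists_le
  obtain ⟨b', hb'⟩ := exists_gt b
  have hfb : f ∈ lowerPart K (order m n t) b' := fun e he =>
    (hb _ (Finset.mem_image_of_mem _ he)).trans_lt hb'
  clear hb hb' b
  induction b' using WellFoundedLT.induction generalizing f with
  | ind b ih =>
    rcases eq_or_ne f 0 with rfl | h0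
    · exact zero_mem _
    obtain ⟨D, hD, hmax⟩ := f.support.exists_max_image (order m n t) (support_nonempty.2 h0)
    obtain ⟨q, ⟨p, rfl⟩, hq⟩ := (isStandard_of_invariant hf hD hmax).exists_mem_range K
    have hlow : f - monomial D (coeff D f) ∈ lowerPart K (order m n t) (order m n t D) :=
      fun e he => by
        have he' : coeff e (f - monomial D (coeff D f)) ≠ 0 := mem_support_iff.1 he
        rw [coeff_sub, coeff_monomial] at he'
        have hne : e ≠ D := by
          rintro rfl
          simp at he'
        rw [if_neg hne.symm, sub_zero] at he'
        exact (hmax e (mem_support_iff.2 he')).lt_of_ne (order_injective.ne hne)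
    have hmem := ih _ (hfb hD) (f := f - coeff D f • aeval (mulVar K m n t) p)
      (fun g => by rw [map_sub, map_smul, hf, aeval_act_aeval_mulVar]) (by
        have := sub_mem hlow (Submodule.smul_mem _ (coeff D f) hq)
        rwa [smul_sub, smul_monomial, smul_eq_mul, mul_one, sub_sub_sub_cancel_right] at this)
    simpa using add_mem hmem (Subalgebra.smul_mem _ (AlgHom.mem_range_self _ p) (coeff D f))

end Invariants

end GLInvariants

/-- **First fundamental theorem of invariant theory for `GLₜ`.**
The `GLₜ(K)`-invariants of `O(M_{m,t}) ⊗ O(M_{t,n}) = K[Y_{ik}, Z_{kj}]` (encoded as the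
polynomial algebra on `(Fin m × Fin t) ⊕ (Fin t × Fin n)`, the `inl` variables being the
`Y_{ik}` and the `inr` variables the `Z_{kj}`) coincide with the image of the algebra morphism
`θ* : K[X_{ij}] → K[Y_{ik}, Z_{kj}]`, `X_{ij} ↦ ∑ₖ Y_{ik} Z_{kj}`. -/
theorem first_fundamental_theorem_GL
    (K : Type*) [Field K] [Infinite K] (m n t : ℕ) (hm : 0 < m) (hn : 0 < n) (ht : 0 < t) :
    {f : MvPolynomial ((Fin m × Fin t) ⊕ (Fin t × Fin n)) K |
      ∀ g : GL (Fin t) K,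
        MvPolynomial.aeval
          (Sum.elim
            (fun p : Fin m × Fin t =>
              ∑ l : Fin t,
                (X (Sum.inl (p.1, l)) : MvPolynomial ((Fin m × Fin t) ⊕ (Fin t × Fin n)) K) *
                  C ((g : Matrix (Fin t) (Fin t) K) l p.2))
            (fun p : Fin t × Fin n =>
              ∑ l : Fin t,
                C (((g⁻¹ : GL (Fin t) K) : Matrix (Fin t) (Fin t) K) p.1 l) *
                  X (Sum.inr (l, p.2)))) f = f} =
    Set.range (MvPolynomial.aeval
      (fun p : Fin m × Fin n =>
        ∑ k : Fin t,
          (X (Sum.inl (p.1, k)) : MvPolynomial ((Fin m × Fin t) ⊕ (Fin t × Fin n)) K) *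
            X (Sum.inr (k, p.2))) :
      MvPolynomial (Fin m × Fin n) K → MvPolynomial ((Fin m × Fin t) ⊕ (Fin t × Fin n)) K) := by
  ext f
  refine ⟨GLInvariants.mem_range_of_invariant, ?_⟩
  rintro ⟨p, rfl⟩ g
  exact GLInvariants.aeval_act_aeval_mulVar g p
end

section
/- Let K be a field and m, n, t positive integers. The kernel of the algebra morphism θ* : K[X_{ij}] → K[Y_{ik}, Z_{kj}], θ*(X_{ij}) = Σ_{k=1}^t Y_{ik} Z_{kj}, equals the ideal T_{t+1} of K[X_{ij}] generated by all (t+1) × (t+1) minors of the m × n matrix (X_{ij}); in particular this kernel is the zero ideal when t ≥ min{m, n}. -/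
open MvPolynomial

section Exchange

variable {ι L R : Type*}

/-- Replace the values of `u` on `P` by those of `x`. -/
def replaceOn (P : ι → Prop) [DecidablePred P] (u : ι → L) (x : {i // P i} → L) : ι → L :=
  fun i => if h : P i then x ⟨i, h⟩ else u i

theorem replaceOn_self (P : ι → Prop) [DecidablePred P] (u : ι → L) :
    replaceOn P u (fun i => u i) = u := by
  ext i; simp [replaceOn]

variable [Fintype ι] [CommRing R]

theorem AlternatingMap.eq_zero_of_card_lt {κ N : Type*} [Fintype κ] [AddCommGroup N] [Module R N]
    (f : (ι → R) [⋀^κ]→ₗ[R] N) (h : Fintype.card ι < Fintype.card κ) : f = 0 := by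
  classical exact (Pi.basisFun R ι).ext_alternating fun v hv =>
    (h.not_ge (Fintype.card_le_of_injective v hv)).elim

variable [DecidableEq ι]

/-- The determinant as an alternating function of the rows in `P`, the other rows being fixed. -/
def detOn (P : ι → Prop) [DecidablePred P] (u : ι → ι → R) :
    (ι → R) [⋀^{i // P i}]→ₗ[R] R :=
  { (Matrix.detRowAlternating (n := ι) (R := R)).toMultilinearMap.domDomRestrict P
      (fun j => u j) with
    map_eq_zero_of_eq' := fun v i j hv hij =>
      (Matrix.detRowAlternating (n := ι) (R := R)).map_eq_zero_of_eq
        (fun k => if h : P k then v ⟨k, h⟩ else u k) (i := i) (j := j)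
        (by simpa [i.2, j.2] using hv) (fun h => hij (Subtype.ext h)) }

theorem detOn_apply (P : ι → Prop) [DecidablePred P] (w : L → ι → R) (u : ι → L)
    (x : {i // P i} → L) :
    detOn P (fun i => w (u i)) (fun i => w (x i)) =
      Matrix.det (Matrix.of fun i => w (replaceOn P u x i)) := by
  change Matrix.det _ = _
  congr 1
  ext i j
  by_cases h : P i <;> simp [replaceOn, h]

/-- Plücker exchange: exchanging the entries of `u` in `P` with the entries of `v` in `Q`. -/
theorem det_mul_det_mem_span (w : L → ι → R) (u v : ι → L) (P Q : ι → Prop)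
    [DecidablePred P] [DecidablePred Q]
    (h : Fintype.card ι < Fintype.card {i // P i} + Fintype.card {i // Q i}) :
    Matrix.det (Matrix.of fun i => w (u i)) * Matrix.det (Matrix.of fun i => w (v i)) ∈
      Submodule.span ℤ {z | ∃ σ : Equiv.Perm ({i // P i} ⊕ {i // Q i}),
        (∃ p q, σ (Sum.inl p) = Sum.inr q) ∧
        z = Matrix.det (Matrix.of fun i => w (replaceOn P u
              (fun p => Sum.elim (fun i => u i.1) (fun i => v i.1) (σ (Sum.inl p))) i)) *
            Matrix.det (Matrix.of fun i => w (replaceOn Q v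
              (fun q => Sum.elim (fun i => u i.1) (fun i => v i.1) (σ (Sum.inr q))) i))} := by
  classical
  let a := detOn P (fun i => w (u i))
  let b := detOn Q (fun i => w (v i))
  let g : {i // P i} ⊕ {i // Q i} → L := Sum.elim (fun i => u i.1) (fun i => v i.1)
  have key : ∀ σ : Equiv.Perm ({i // P i} ⊕ {i // Q i}),
      LinearMap.mul' R R (AlternatingMap.domCoprod.summand a b (Quotient.mk'' σ) (w ∘ g)) =
      Equiv.Perm.sign σ • (Matrix.det (Matrix.of fun i => w (replaceOn P u
              (fun p => g (σ (Sum.inl p))) i)) *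
            Matrix.det (Matrix.of fun i => w (replaceOn Q v
              (fun q => g (σ (Sum.inr q))) i))) := by
    intro σ
    rw [AlternatingMap.domCoprod.summand_mk'']
    rw [← detOn_apply, ← detOn_apply]
    rw [_root_.smul_apply, Units.smul_def, Units.smul_def, map_zsmul]
    rfl
  have hz : (AlternatingMap.domCoprod a b) (w ∘ g) = 0 := by
    rw [AlternatingMap.eq_zero_of_card_lt (AlternatingMap.domCoprod a b) (by simpa using h)]
    rfl
  have hs : ∑ σ : Equiv.Perm.ModSumCongr {i // P i} {i // Q i},
      LinearMap.mul' R R (AlternatingMap.domCoprod.summand a b σ (w ∘ g)) = 0 := by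
    rw [AlternatingMap.domCoprod_apply, _root_.sum_apply] at hz
    rw [← map_sum, hz, map_zero]
  have hq := Finset.add_sum_erase Finset.univ
    (fun σ => LinearMap.mul' R R (AlternatingMap.domCoprod.summand a b σ (w ∘ g)))
    (Finset.mem_univ (Quotient.mk'' 1))
  rw [hs, key] at hq
  simp only [Equiv.Perm.sign_one, one_smul, Equiv.Perm.one_apply, g, Sum.elim_inl, Sum.elim_inr,
    replaceOn_self] at hq
  rw [eq_neg_of_add_eq_zero_left hq]
  refine neg_mem (sum_mem fun q hmem => ?_)
  induction q using Quotient.inductionOn' with | _ σ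
  rw [key, Units.smul_def]
  refine Submodule.smul_mem _ _ (Submodule.subset_span ⟨σ, ?_, rfl⟩)
  by_contra! hcon
  refine (Finset.mem_erase.1 hmem).1 (Quotient.sound' ?_)
  rw [QuotientGroup.leftRel_apply, mul_one]
  refine inv_mem (Equiv.Perm.mem_sumCongrHom_range_of_perm_mapsTo_inl ?_)
  rintro _ ⟨p, rfl⟩
  rcases hp : σ (Sum.inl p) with p' | q'
  · exact ⟨p', rfl⟩
  · exact absurd hp (hcon p q')

end Exchange

section Straightening

variable {m n : ℕ} {S : Type*} [CommRing S]

/-- Pairs of a set of rows and a set of columns of the same cardinality: the index set of the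
minors of an `m × n` matrix. -/
abbrev MinorIndex (m n : ℕ) := {p : Finset (Fin m) × Finset (Fin n) // p.2.card = p.1.card}

namespace MinorIndex

/-- The minor of `x` with rows and columns given by `p`. -/
noncomputable def minor (x : Matrix (Fin m) (Fin n) S) (p : MinorIndex m n) : S :=
  (x.submatrix (p.1.1.orderEmbOfFin rfl) (p.1.2.orderEmbOfFin p.2)).det

/-- The columns of the matrix `(x | 1)` whose maximal minor is, up to sign, the minor `p` of `x`. -/
def columns (p : MinorIndex m n) : Finset (Fin n ⊕ Fin m) := p.1.2.disjSum p.1.1ᶜ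

theorem card_columns (p : MinorIndex m n) : p.columns.card = m := by
  have := p.2
  have h := Finset.card_le_univ p.1.1
  simp only [columns, Finset.card_disjSum, Finset.card_compl, Fintype.card_fin] at *
  omega

theorem exists_columns_eq (c : Finset (Fin n ⊕ Fin m)) (hc : c.card = m) :
    ∃ p : MinorIndex m n, p.columns = c := by
  refine ⟨⟨(c.toRightᶜ, c.toLeft), ?_⟩, ?_⟩
  · have := c.card_toLeft_add_card_toRight
    have h := Finset.card_le_univ c.toRight
    simp only [Finset.card_compl, Fintype.card_fin] at *
    omega
  · simp [columns, Finset.toLeft_disjSum_toRight]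

/-- The position of a column of `(x | 1)`, where the columns of the identity matrix are listed
in reverse order. -/
def pos : Fin n ⊕ Fin m → ℕ := Sum.elim (fun j => j) (fun i => n + (m - 1 - i))

/-- The `l`-th column of `(x | 1)`. -/
def augment (x : Matrix (Fin m) (Fin n) S) : Fin n ⊕ Fin m → Fin m → S :=
  Sum.elim (fun j i => x i j) (fun i => Pi.single i 1)

theorem det_augment (x : Matrix (Fin m) (Fin n) S) (p : MinorIndex m n)
    (v : Fin m → Fin n ⊕ Fin m) (hv : Finset.univ.image v = p.columns) :
    ∃ ε : ℤˣ, (Matrix.of fun i => augment x (v i)).det = ε • p.minor x := by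
  let g : Fin p.1.1.card ⊕ {i // i ∈ p.1.1ᶜ} → Fin n ⊕ Fin m :=
    Sum.map (p.1.2.orderEmbOfFin p.2) Subtype.val
  let f : Fin p.1.1.card ⊕ {i // i ∈ p.1.1ᶜ} → Fin m :=
    Sum.elim (p.1.1.orderEmbOfFin rfl) Subtype.val
  have hcard : Fintype.card (Fin p.1.1.card ⊕ {i // i ∈ p.1.1ᶜ}) = Fintype.card (Fin m) := by
    have h := Finset.card_le_univ p.1.1
    simp only [Fintype.card_sum, Fintype.card_coe, Finset.card_compl, Fintype.card_fin] at *
    omega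
  have hf : Function.Injective f := by
    refine (p.1.1.orderEmbOfFin rfl).injective.sumElim Subtype.val_injective fun k i h => ?_
    have := p.1.1.orderEmbOfFin_mem rfl k
    exact (Finset.mem_compl.1 i.2) (h ▸ this)
  have hg : Function.Injective g :=
    (p.1.2.orderEmbOfFin p.2).injective.sumMap Subtype.val_injective
  have hex : ∀ y, ∃ i, v i = g y := by
    intro y
    have : g y ∈ Finset.univ.image v := by
      rw [hv]
      rcases y with k | i
      · simp [g, columns]
      · simp [g, columns]
    simpa using this
  choose e he using hex
  have hei : Function.Injective e := fun a b h => hg (by rw [← he, ← he, h])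
  let e₁ := Equiv.ofBijective e ((Fintype.bijective_iff_injective_and_card e).2 ⟨hei, hcard⟩)
  let e₂ := Equiv.ofBijective f ((Fintype.bijective_iff_injective_and_card f).2 ⟨hf, hcard⟩)
  set M : Matrix (Fin m) (Fin m) S := Matrix.of fun i => augment x (v i)
  have hM : M.reindex e₁.symm e₂.symm = Matrix.fromBlocks
      (x.submatrix (p.1.1.orderEmbOfFin rfl) (p.1.2.orderEmbOfFin p.2)).transpose
      (M.submatrix (e₁ ∘ Sum.inl) (e₂ ∘ Sum.inr)) 0 1 := by
    ext a b
    rcases a with a | a <;> rcases b with b | b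
    · simp [M, e₁, e₂, he, g, f, augment]
    · simp
    · have : (p.1.1.orderEmbOfFin rfl b) ≠ a := fun h =>
        (Finset.mem_compl.1 a.2) (h ▸ p.1.1.orderEmbOfFin_mem rfl b)
      simp [M, e₁, e₂, he, g, f, augment, this]
    · rcases eq_or_ne a b with rfl | hab
      · simp [M, e₁, e₂, he, g, f, augment]
      · have : b.1 ≠ a.1 := fun h => hab (Subtype.ext h.symm)
        simp [M, e₁, e₂, he, g, f, augment, this, hab]
  have hdet := Matrix.det_reindex e₁.symm e₂.symm M
  rw [hM, Matrix.det_fromBlocks_zero₂₁, Matrix.det_one, mul_one, Matrix.det_transpose] at hdet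
  refine ⟨Equiv.Perm.sign (e₂.symm.trans e₁.symm.symm), ?_⟩
  rw [minor, hdet, Units.smul_def, zsmul_eq_mul, ← mul_assoc, ← Int.cast_mul]
  simp

/-- The number of columns among the first `l + 1` positions. -/
def rank (p : MinorIndex m n) (l : ℕ) : ℕ := (p.columns.filter fun c => pos c ≤ l).card

/-- The partial order of standard monomial theory. -/
def Precedes (p q : MinorIndex m n) : Prop := ∀ l, q.rank l ≤ p.rank l

/-- The sum of the positions of the columns. -/
def weight (p : MinorIndex m n) : ℕ := ∑ c ∈ p.columns, pos c

theorem exists_image_eq_columns (p : MinorIndex m n) :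
    ∃ v : Fin m → Fin n ⊕ Fin m, Function.Injective v ∧ Finset.univ.image v = p.columns := by
  let e := (p.columns.equivFinOfCardEq p.card_columns).symm
  refine ⟨fun i => e i, Subtype.val_injective.comp e.injective, ?_⟩
  ext c
  simp only [Finset.mem_image, Finset.mem_univ, true_and]
  exact ⟨fun ⟨i, hi⟩ => hi ▸ (e i).2, fun h => ⟨e.symm ⟨c, h⟩, by simp⟩⟩

theorem det_augment_eq_zero_or (x : Matrix (Fin m) (Fin n) S) (v : Fin m → Fin n ⊕ Fin m) :
    (Matrix.of fun i => augment x (v i)).det = 0 ∨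
      ∃ q : MinorIndex m n, q.weight = ∑ i, pos (v i) ∧
        ∃ ε : ℤˣ, (Matrix.of fun i => augment x (v i)).det = ε • q.minor x := by
  by_cases hv : Function.Injective v
  · right
    obtain ⟨q, hq⟩ := exists_columns_eq (Finset.univ.image v)
      (by rw [Finset.card_image_of_injective _ hv]; simp)
    exact ⟨q, by rw [weight, hq, Finset.sum_image fun _ _ _ _ h => hv h],
      det_augment x q v hq.symm⟩
  · left
    simp only [Function.Injective, not_forall] at hv
    obtain ⟨i, j, hij, hne⟩ := hv
    exact Matrix.det_zero_of_row_eq hne (by ext; simp [hij])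

end MinorIndex

theorem sum_replaceOn {ι L : Type*} [Fintype ι] (P : ι → Prop) [DecidablePred P] (u : ι → L)
    (y : {i // P i} → L) (f : L → ℕ) :
    ∑ i, f (replaceOn P u y i) + ∑ i : {i // P i}, f (u i) =
      ∑ i, f (u i) + ∑ i, f (y i) := by
  rw [← Fintype.sum_subtype_add_sum_subtype P fun i => f (replaceOn P u y i),
    ← Fintype.sum_subtype_add_sum_subtype P fun i => f (u i)]
  have h1 : ∑ i : {i // P i}, f (replaceOn P u y i) = ∑ i, f (y i) :=
    Finset.sum_congr rfl fun i _ => by simp [replaceOn, i.2]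
  have h2 : ∑ i : {i // ¬P i}, f (replaceOn P u y i) = ∑ i : {i // ¬P i}, f (u i) :=
    Finset.sum_congr rfl fun i _ => by simp [replaceOn, i.2]
  omega

theorem sum_perm_inl_lt {α β : Type*} [Fintype α] [Fintype β] (h : α ⊕ β → ℕ) (l : ℕ)
    (hα : ∀ a, l < h (Sum.inl a)) (hβ : ∀ b, h (Sum.inr b) ≤ l) (σ : Equiv.Perm (α ⊕ β))
    (hσ : ∃ a b, σ (Sum.inl a) = Sum.inr b) :
    ∑ a, h (σ (Sum.inl a)) < ∑ a, h (Sum.inl a) := by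
  let d : α ⊕ β → ℤ := fun y => 2 * ((h y : ℤ) - l) - 1
  have hsum : ∑ a, max (d (σ (Sum.inl a))) 0 + ∑ b, max (d (σ (Sum.inr b))) 0 =
      ∑ a, max (d (Sum.inl a)) 0 + ∑ b, max (d (Sum.inr b)) 0 := by
    rw [← Fintype.sum_sum_type (fun y => max (d (σ y)) 0),
      ← Fintype.sum_sum_type (fun y => max (d y) 0)]
    exact Equiv.sum_comp σ fun y => max (d y) 0
  have h1 : ∑ b, max (d (Sum.inr b)) 0 = 0 :=
    Finset.sum_eq_zero fun b _ => max_eq_right (by have := hβ b; simp only [d]; omega)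
  have h2 : ∑ a, max (d (Sum.inl a)) 0 = ∑ a, d (Sum.inl a) :=
    Finset.sum_congr rfl fun a _ => max_eq_left (by have := hα a; simp only [d]; omega)
  have h3 : 0 ≤ ∑ b, max (d (σ (Sum.inr b))) 0 := Finset.sum_nonneg fun b _ => le_max_right _ _
  have h4 : ∑ a, d (σ (Sum.inl a)) < ∑ a, max (d (σ (Sum.inl a))) 0 := by
    obtain ⟨a, b, hab⟩ := hσ
    refine Finset.sum_lt_sum (fun a _ => le_max_left _ _) ⟨a, Finset.mem_univ _, ?_⟩
    have := hβ b
    rw [lt_max_iff, hab]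
    right
    simp only [d]
    omega
  have h5 : ∑ a, d (σ (Sum.inl a)) < ∑ a, d (Sum.inl a) := by linarith
  simp only [d, Finset.sum_sub_distrib, ← Finset.mul_sum] at h5
  have : ∑ a, (h (σ (Sum.inl a)) : ℤ) < ∑ a, (h (Sum.inl a) : ℤ) := by linarith
  exact_mod_cast this

namespace MinorIndex

theorem rank_eq_card (p : MinorIndex m n) (v : Fin m → Fin n ⊕ Fin m) (hv : Function.Injective v)
    (hp : Finset.univ.image v = p.columns) (l : ℕ) :
    p.rank l = Fintype.card {i // pos (v i) ≤ l} := by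
  rw [rank, ← hp, Finset.filter_image, Finset.card_image_of_injective _ hv, Fintype.card_subtype]

theorem minor_mul_minor_mem_span (x : Matrix (Fin m) (Fin n) S) (p p' : MinorIndex m n)
    (h : ¬ p.Precedes p') :
    p.minor x * p'.minor x ∈ Submodule.span ℤ {z | ∃ q q' : MinorIndex m n,
      q.weight < p.weight ∧ q.weight + q'.weight = p.weight + p'.weight ∧
      z = q.minor x * q'.minor x} := by
  simp only [Precedes, not_forall, not_le] at h
  obtain ⟨l, hl⟩ := h
  obtain ⟨u, hu, hup⟩ := p.exists_image_eq_columns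
  obtain ⟨v, hv, hvp⟩ := p'.exists_image_eq_columns
  have hpw : p.weight = ∑ i, pos (u i) := by
    rw [weight, ← hup, Finset.sum_image fun _ _ _ _ h => hu h]
  have hpw' : p'.weight = ∑ i, pos (v i) := by
    rw [weight, ← hvp, Finset.sum_image fun _ _ _ _ h => hv h]
  rw [rank_eq_card p u hu hup, rank_eq_card p' v hv hvp] at hl
  have hcard : Fintype.card (Fin m) <
      Fintype.card {i // ¬ pos (u i) ≤ l} + Fintype.card {i // pos (v i) ≤ l} := by
    have := Fintype.card_subtype_compl fun i => pos (u i) ≤ l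
    have := Fintype.card_subtype_le fun i => pos (u i) ≤ l
    omega
  have key := det_mul_det_mem_span (augment x) u v _ _ hcard
  obtain ⟨ε, hε⟩ := det_augment x p u hup
  obtain ⟨ε', hε'⟩ := det_augment x p' v hvp
  rw [hε, hε', smul_mul_smul_comm] at key
  have key2 : p.minor x * p'.minor x = ((ε * ε')⁻¹ : ℤˣ) • ((ε * ε') •
      (p.minor x * p'.minor x)) := by rw [inv_smul_smul]
  rw [key2]
  refine Submodule.smul_mem _ _ (Submodule.span_le.2 ?_ key)
  rintro _ ⟨σ, hσ, rfl⟩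
  set g : {i // ¬ pos (u i) ≤ l} ⊕ {i // pos (v i) ≤ l} → Fin n ⊕ Fin m :=
    Sum.elim (fun i => u i.1) (fun i => v i.1)
  have hlt := sum_perm_inl_lt (fun y => pos (g y)) l (fun a => not_le.1 a.2) (fun b => b.2) σ hσ
  have htot : ∑ a, pos (g (σ (Sum.inl a))) + ∑ b, pos (g (σ (Sum.inr b))) =
      ∑ a, pos (g (Sum.inl a)) + ∑ b, pos (g (Sum.inr b)) := by
    rw [← Fintype.sum_sum_type (fun y => pos (g (σ y))),
      ← Fintype.sum_sum_type (fun y => pos (g y))]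
    exact Equiv.sum_comp σ fun y => pos (g y)
  have hs1 := sum_replaceOn (fun i => ¬ pos (u i) ≤ l) u (fun a => g (σ (Sum.inl a))) pos
  have hs2 := sum_replaceOn (fun i => pos (v i) ≤ l) v (fun a => g (σ (Sum.inr a))) pos
  have hg1 : ∑ a, pos (g (Sum.inl a)) = ∑ i : {i // ¬ pos (u i) ≤ l}, pos (u i) := rfl
  have hg2 : ∑ a, pos (g (Sum.inr a)) = ∑ i : {i // pos (v i) ≤ l}, pos (v i) := rfl
  rcases det_augment_eq_zero_or x (replaceOn (fun i => ¬ pos (u i) ≤ l) u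
    (fun a => g (σ (Sum.inl a)))) with h0 | ⟨q, hq, δ, hδ⟩
  · rw [h0, zero_mul]
    exact zero_mem _
  rcases det_augment_eq_zero_or x (replaceOn (fun i => pos (v i) ≤ l) v
    (fun a => g (σ (Sum.inr a)))) with h0 | ⟨q', hq', δ', hδ'⟩
  · rw [h0, mul_zero]
    exact zero_mem _
  rw [hδ, hδ', smul_mul_smul_comm]
  refine Submodule.smul_mem _ _ (Submodule.subset_span ⟨q, q', ?_, ?_, rfl⟩)
  · omega
  · omega

/-- A multiset of minors is standard if its members are pairwise comparable. -/
def IsStandard (T : Multiset (MinorIndex m n)) : Prop :=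
  ∀ p ∈ T, ∀ q ∈ T, p.Precedes q ∨ q.Precedes p

theorem prod_minor_mem_span (x : Matrix (Fin m) (Fin n) S) (T : Multiset (MinorIndex m n)) :
    (T.map (minor x)).prod ∈ Submodule.span ℤ {z | ∃ T' : Multiset (MinorIndex m n),
      IsStandard T' ∧ z = (T'.map (minor x)).prod} := by
  obtain ⟨B, hB⟩ : ∃ B, ∀ p : MinorIndex m n, p.weight ^ 2 ≤ B :=
    ⟨Finset.univ.sup fun p : MinorIndex m n => p.weight ^ 2, fun p =>
      Finset.le_sup (f := fun p : MinorIndex m n => p.weight ^ 2) (Finset.mem_univ p)⟩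
  have hbound : ∀ T : Multiset (MinorIndex m n),
      (T.map fun p => weight p ^ 2).sum ≤ T.card * B := by
    intro T
    simpa using Multiset.sum_le_card_nsmul (T.map fun p => weight p ^ 2) B fun y hy => by
      obtain ⟨p, -, rfl⟩ := Multiset.mem_map.1 hy
      exact hB p
  induction hN : T.card * B - (T.map fun p => weight p ^ 2).sum using Nat.strong_induction_on
    generalizing T with
  | _ N ih =>
  by_cases hT : IsStandard T
  · exact Submodule.subset_span ⟨T, hT, rfl⟩
  obtain ⟨p, hp, q, hq, hpq, hqp, hw⟩ : ∃ p ∈ T, ∃ q ∈ T, ¬ p.Precedes q ∧ ¬ q.Precedes p ∧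
      p.weight ≤ q.weight := by
    simp only [IsStandard, not_forall, not_or] at hT
    obtain ⟨p, hp, q, hq, hpq, hqp⟩ := hT
    rcases le_total p.weight q.weight with h | h
    · exact ⟨p, hp, q, hq, hpq, hqp, h⟩
    · exact ⟨q, hq, p, hp, hqp, hpq, h⟩
  have hne : q ≠ p := by
    rintro rfl
    exact hpq fun _ => le_rfl
  obtain ⟨T₁, rfl⟩ := Multiset.exists_cons_of_mem hp
  obtain ⟨T₀, rfl⟩ := Multiset.exists_cons_of_mem ((Multiset.mem_cons.1 hq).resolve_left hne)
  rw [Multiset.map_cons, Multiset.map_cons, Multiset.prod_cons, Multiset.prod_cons, ← mul_assoc]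
  change p.minor x * q.minor x ∈ Submodule.comap
    (LinearMap.mulRight ℤ (T₀.map (minor x)).prod) (Submodule.span ℤ _)
  refine Submodule.span_le.2 ?_ (minor_mul_minor_mem_span x p q hpq)
  rintro _ ⟨a, b, ha, hab, rfl⟩
  have hb := hbound (a ::ₘ b ::ₘ T₀)
  have := ih _ ?_ (a ::ₘ b ::ₘ T₀) rfl
  · simpa [mul_assoc] using this
  · have hlt : p.weight ^ 2 + q.weight ^ 2 < a.weight ^ 2 + b.weight ^ 2 := by
      obtain ⟨k, hk⟩ := Nat.exists_eq_add_of_lt ha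
      obtain ⟨j, hj⟩ := Nat.exists_eq_add_of_le hw
      have : b.weight = q.weight + k + 1 := by omega
      rw [this, hj, hk]
      nlinarith
    simp only [Multiset.map_cons, Multiset.sum_cons, Multiset.card_cons] at hN hb ⊢
    omega

end MinorIndex

end Straightening

section LeastTerm

variable {σ R : Type*} [CommRing R]

/-- `μ` is the unique monomial of `f` of least weight, and its coefficient is `1`. -/
def HasLeastTerm (w : (σ →₀ ℕ) →+ ℕ) (f : MvPolynomial σ R) (μ : σ →₀ ℕ) : Prop :=
  f.coeff μ = 1 ∧ ∀ ν, f.coeff ν ≠ 0 → ν ≠ μ → w μ < w ν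

namespace HasLeastTerm

variable {w : (σ →₀ ℕ) →+ ℕ}

theorem one : HasLeastTerm w (1 : MvPolynomial σ R) 0 := by
  classical
  refine ⟨coeff_zero_one, fun ν hν hne => absurd ?_ hν⟩
  rw [coeff_one, if_neg hne.symm]

theorem le {f : MvPolynomial σ R} {μ : σ →₀ ℕ} (hf : HasLeastTerm w f μ) {ν : σ →₀ ℕ}
    (hν : f.coeff ν ≠ 0) : w μ ≤ w ν := by
  rcases eq_or_ne ν μ with rfl | h
  · exact le_rfl
  · exact (hf.2 ν hν h).le

theorem mul {f g : MvPolynomial σ R} {μ ν : σ →₀ ℕ} (hf : HasLeastTerm w f μ)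
    (hg : HasLeastTerm w g ν) : HasLeastTerm w (f * g) (μ + ν) := by
  classical
  constructor
  · rw [coeff_mul, Finset.sum_eq_single (μ, ν)]
    · rw [hf.1, hg.1, one_mul]
    · rintro ⟨a, b⟩ hab hne
      replace hab : a + b = μ + ν := Finset.HasAntidiagonal.mem_antidiagonal.1 hab
      by_contra h
      have ha := left_ne_zero_of_mul h
      have hb := right_ne_zero_of_mul h
      have hw := congrArg w hab
      rw [map_add, map_add] at hw
      have h1 : w μ ≤ w a := hf.le ha
      have h2 : w ν ≤ w b := hg.le hb
      have ha' : a = μ := by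
        by_contra hne
        have := hf.2 a ha hne
        omega
      have hb' : b = ν := by
        by_contra hne
        have := hg.2 b hb hne
        omega
      exact hne (by rw [ha', hb'])
    · simp
  · intro κ hκ hne
    rw [coeff_mul] at hκ
    obtain ⟨⟨a, b⟩, hab, h⟩ := Finset.exists_ne_zero_of_sum_ne_zero hκ
    rw [Finset.HasAntidiagonal.mem_antidiagonal] at hab
    have ha := left_ne_zero_of_mul h
    have hb := right_ne_zero_of_mul h
    rw [← hab, map_add, map_add]
    rcases eq_or_ne a μ with rfl | hne1
    · exact Nat.add_lt_add_left (hg.2 b hb fun h => hne (by rw [← hab, h])) _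
    · exact Nat.add_lt_add_of_lt_of_le (hf.2 a ha hne1) (hg.le hb)

theorem multiset_prod {ι : Type*} (f : ι → MvPolynomial σ R) (μ : ι → σ →₀ ℕ)
    (h : ∀ i, HasLeastTerm w (f i) (μ i)) (T : Multiset ι) :
    HasLeastTerm w (T.map f).prod (T.map μ).sum := by
  induction T using Multiset.induction with
  | empty => simpa using one
  | cons a T ih => simpa using (h a).mul ih

theorem sum_monomial {ι : Type*} [Fintype ι] (ν : ι → σ →₀ ℕ) (c : ι → R)
    (i₀ : ι) (hc : c i₀ = 1) (h : ∀ i, c i ≠ 0 → i ≠ i₀ → w (ν i₀) < w (ν i)) :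
    HasLeastTerm w (∑ i, monomial (ν i) (c i)) (ν i₀) := by
  classical
  constructor
  · rw [coeff_sum, Finset.sum_eq_single i₀]
    · rw [coeff_monomial, if_pos rfl, hc]
    · intro i _ hne
      rw [coeff_monomial]
      split_ifs with he
      · by_contra h0
        exact absurd (h i h0 hne) (by rw [he]; exact lt_irrefl _)
      · rfl
    · simp
  · intro κ hκ hne
    rw [coeff_sum] at hκ
    obtain ⟨i, -, hi⟩ := Finset.exists_ne_zero_of_sum_ne_zero hκ
    rw [coeff_monomial] at hi
    split_ifs at hi with he
    · rw [← he]
      refine h i hi ?_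
      rintro rfl
      exact hne he.symm
    · exact absurd rfl hi

theorem linearIndependent {ι : Type*} (f : ι → MvPolynomial σ R) (μ : ι → σ →₀ ℕ)
    (h : ∀ i, HasLeastTerm w (f i) (μ i)) (hμ : Function.Injective μ) :
    LinearIndependent R f := by
  rw [linearIndependent_iff]
  intro l hl
  by_contra hne
  obtain ⟨i, hi, hmin⟩ := l.support.exists_min_image (fun i => w (μ i))
    (Finsupp.support_nonempty_iff.2 hne)
  refine Finsupp.mem_support_iff.1 hi ?_
  have := congrArg (coeff (μ i)) hl
  rw [Finsupp.linearCombination_apply, Finsupp.sum, coeff_sum, Finset.sum_eq_single i,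
    coeff_smul, (h i).1, smul_eq_mul, mul_one, coeff_zero] at this
  · exact this
  · intro j hj hji
    rw [coeff_smul, smul_eq_mul]
    by_contra h0
    exact (hmin j hj).not_gt ((h j).2 _ (right_ne_zero_of_mul h0) fun he => hji (hμ he.symm))
  · exact fun h => absurd hi h

end HasLeastTerm

end LeastTerm

section Rearrangement

theorem sum_val_le_sum_of_injective {s : ℕ} (f : Fin s → ℕ) (hf : Function.Injective f) :
    ∑ i : Fin s, (i : ℕ) ≤ ∑ i, f i := by
  have hinj : Function.Injective fun i => (f i : ℤ) := Nat.cast_injective.comp hf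
  have h := Finset.sum_range_le_sum (s := Finset.univ.image fun i => (f i : ℤ)) (c := 0)
    (by simp)
  rw [Finset.card_image_of_injective _ hinj, Finset.sum_image fun _ _ _ _ h => hinj h,
    Finset.card_univ, Fintype.card_fin, Finset.sum_range] at h
  simp only [zero_add] at h
  exact_mod_cast h

theorem sum_val_mul_le_of_injective {s : ℕ} (f α : Fin s → ℕ) (hf : Function.Injective f)
    (hα : StrictAnti α) (hpos : ∀ i, 0 < α i) :
    ∑ i : Fin s, (i : ℕ) * α i ≤ ∑ i, f i * α i ∧
      (∑ i, f i * α i = ∑ i : Fin s, (i : ℕ) * α i → ∀ i, f i = i) := by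
  induction s with
  | zero => simp
  | succ s ih =>
    have hlast : ∀ i : Fin s, α (Fin.last s) < α i.castSucc := fun i => hα (Fin.castSucc_lt_last i)
    obtain ⟨h1, h2⟩ := ih (fun i => f i.castSucc) (fun i => α i.castSucc - α (Fin.last s))
      (hf.comp (Fin.castSucc_injective s))
      (fun i j hij => by
        have := hα (Fin.castSucc_lt_castSucc_iff.2 hij)
        have := hlast i
        have := hlast j
        dsimp only
        omega)
      (fun i => Nat.sub_pos_of_lt (hlast i))
    have h3 := sum_val_le_sum_of_injective f hf
    have split : ∀ g : Fin (s + 1) → ℕ, ∑ i, g i * α i =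
        ∑ i : Fin s, g i.castSucc * (α i.castSucc - α (Fin.last s)) +
          (∑ i, g i) * α (Fin.last s) := by
      intro g
      rw [Fin.sum_univ_castSucc, Fin.sum_univ_castSucc (f := g), add_mul, ← add_assoc,
        Finset.sum_mul, ← Finset.sum_add_distrib]
      congr 1
      refine Finset.sum_congr rfl fun i _ => ?_
      rw [← mul_add, Nat.sub_add_cancel (hlast i).le]
    rw [split f, split fun i => (i : ℕ)]
    simp only [Fin.val_castSucc]
    have h4 := Nat.mul_le_mul_right (α (Fin.last s)) h3
    refine ⟨by omega, fun heq => ?_⟩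
    have h5 := h2 (by omega)
    have h6 : ∑ i, f i = ∑ i : Fin (s + 1), (i : ℕ) :=
      Nat.eq_of_mul_eq_mul_right (hpos (Fin.last s)) (by omega)
    rw [Fin.sum_univ_castSucc, Fin.sum_univ_castSucc (f := fun i : Fin (s + 1) => (i : ℕ)),
      Finset.sum_congr rfl fun i _ => h5 i] at h6
    intro i
    induction i using Fin.lastCases with
    | last => simpa using h6
    | cast i => simpa using h5 i

end Rearrangement

section LeastTermOfMinor

variable {m n t s : ℕ} {R : Type*} [CommRing R]

/-- The product of the generic `m × t` and `t × n` matrices. -/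
noncomputable def genericMul (m n t : ℕ) (R : Type*) [CommRing R] :
    Matrix (Fin m) (Fin n) (MvPolynomial ((Fin m × Fin t) ⊕ (Fin t × Fin n)) R) :=
  Matrix.of fun i j => ∑ k : Fin t, X (Sum.inl (i, k)) * X (Sum.inr (k, j))

/-- The exponent of `∏ i, Y (r i) (f i) * Z (f i) (c i)`. -/
noncomputable def pathExponent (r : Fin s → Fin m) (c : Fin s → Fin n) (f : Fin s → Fin t) :
    (Fin m × Fin t) ⊕ (Fin t × Fin n) →₀ ℕ :=
  ∑ i, (Finsupp.single (Sum.inl (r i, f i)) 1 + Finsupp.single (Sum.inr (f i, c i)) 1)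

open Classical in
theorem det_genericMul_submatrix (r : Fin s → Fin m) (c : Fin s → Fin n) :
    ((genericMul m n t R).submatrix r c).det =
      ∑ x : (Fin s → Fin t) × Equiv.Perm (Fin s), monomial (pathExponent (r ∘ x.2) c x.1)
        (if Function.Injective x.1 then ((Equiv.Perm.sign x.2 : ℤ) : R) else 0) := by
  have key : ∀ (f : Fin s → Fin t) (σ : Equiv.Perm (Fin s)),
      monomial (pathExponent (r ∘ σ) c f) (((Equiv.Perm.sign σ : ℤ) : R)) =
      ((Equiv.Perm.sign σ : ℤ) : MvPolynomial ((Fin m × Fin t) ⊕ (Fin t × Fin n)) R) *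
        ∏ i, (X (Sum.inl (r (σ i), f i)) * X (Sum.inr (f i, c i))) := by
    intro f σ
    rw [← mul_one (((Equiv.Perm.sign σ : ℤ) : R)), ← C_mul_monomial, pathExponent,
      monomial_sum_one, map_intCast]
    congr 1
    refine Finset.prod_congr rfl fun i _ => ?_
    simp [X, monomial_mul]
  rw [Matrix.det_apply', Fintype.sum_prod_type]
  simp only [genericMul, Matrix.submatrix_apply, Matrix.of_apply]
  simp_rw [Finset.prod_univ_sum, Finset.mul_sum, Fintype.piFinset_univ]
  rw [Finset.sum_comm]
  refine Finset.sum_congr rfl fun f _ => ?_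
  split_ifs with hf
  · exact Finset.sum_congr rfl fun σ _ => (key f σ).symm
  · simp only [monomial_zero, Finset.sum_const_zero]
    simp only [Function.Injective, not_forall] at hf
    obtain ⟨i, j, hij, hne⟩ := hf
    have := Matrix.det_zero_of_column_eq (M := Matrix.of fun a b =>
      (X (Sum.inl (r a, f b)) : MvPolynomial ((Fin m × Fin t) ⊕ (Fin t × Fin n)) R)) hne
      (by simp [hij])
    rw [Matrix.det_apply'] at this
    simp_rw [Finset.prod_mul_distrib, ← mul_assoc]
    rw [← Finset.sum_mul]
    simp only [Matrix.of_apply] at this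
    rw [this, zero_mul]

theorem det_genericMul_submatrix_eq_zero (hs : t < s) (r : Fin s → Fin m) (c : Fin s → Fin n) :
    ((genericMul m n t R).submatrix r c).det = 0 := by
  rw [det_genericMul_submatrix]
  refine Finset.sum_eq_zero fun x _ => ?_
  rw [if_neg, monomial_zero]
  intro h
  have := Fintype.card_le_of_injective _ h
  simp only [Fintype.card_fin] at this
  omega

/-- A weight for which the diagonal path is the least one in every minor of `genericMul`. -/
noncomputable def pathWeight (m n t : ℕ) :
    ((Fin m × Fin t) ⊕ (Fin t × Fin n) →₀ ℕ) →+ ℕ :=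
  Finsupp.weight (Sum.elim (fun p => p.2 * (m - p.1)) (fun p => p.1 * (n - p.2)))

theorem pathWeight_pathExponent (r : Fin s → Fin m) (c : Fin s → Fin n) (f : Fin s → Fin t) :
    pathWeight m n t (pathExponent r c f) =
      ∑ i, (f i : ℕ) * (m - r i) + ∑ i, (f i : ℕ) * (n - c i) := by
  simp [pathWeight, pathExponent, map_sum, Finsupp.weight_single, Finset.sum_add_distrib]

theorem hasLeastTerm_det_genericMul (hs : s ≤ t) (r : Fin s → Fin m) (c : Fin s → Fin n)
    (hr : StrictMono r) (hc : StrictMono c) :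
    HasLeastTerm (pathWeight m n t) ((genericMul m n t R).submatrix r c).det
      (pathExponent r c (Fin.castLE hs)) := by
  classical
  rw [det_genericMul_submatrix]
  refine HasLeastTerm.sum_monomial
    (fun x : (Fin s → Fin t) × Equiv.Perm (Fin s) => pathExponent (r ∘ x.2) c x.1) _
    (Fin.castLE hs, 1) (by simp [Fin.castLE_injective]) ?_
  rintro ⟨f, σ⟩ hf hne
  have hf : Function.Injective f := by
    by_contra h
    simp [h] at hf
  have hf' : Function.Injective fun i => (f i : ℕ) := Fin.val_injective.comp hf
  have anti : ∀ {d : ℕ} (a : Fin s → Fin d), StrictMono a → StrictAnti fun i => d - (a i : ℕ) :=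
    fun a ha i j hij => by
      have : (a i : ℕ) < a j := ha hij
      have := (a j).2
      dsimp only
      omega
  obtain ⟨h1, h1'⟩ := sum_val_mul_le_of_injective (fun i => (f i : ℕ)) _ hf' (anti c hc)
    fun i => Nat.sub_pos_of_lt (c i).2
  obtain ⟨h2, h2'⟩ := sum_val_mul_le_of_injective (fun i => (f (σ⁻¹ i) : ℕ)) _
    (hf'.comp σ⁻¹.injective) (anti r hr) fun i => Nat.sub_pos_of_lt (r i).2
  have h3 : ∑ i, (f (σ⁻¹ i) : ℕ) * (m - r i) = ∑ i, (f i : ℕ) * (m - r (σ i)) := by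
    rw [← Equiv.sum_comp σ]
    simp
  simp only [pathWeight_pathExponent, Function.comp_apply, Equiv.Perm.coe_one, id_eq,
    Fin.val_castLE]
  by_contra hlt
  have hfi := h1' (by omega)
  have hσi := h2' (by omega)
  refine hne (Prod.ext (funext fun i => Fin.ext (hfi i)) (Equiv.ext fun i => ?_))
  have := hσi (σ i)
  rw [show σ⁻¹ (σ i) = i from σ.symm_apply_apply i, hfi] at this
  exact Fin.ext this.symm

end LeastTermOfMinor

section Decoding

theorem lt_card_filter_le_iff {d s : ℕ} (A : Finset (Fin d)) (hA : A.card = s) (k : ℕ)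
    (i : Fin d) : k < (A.filter fun a => a ≤ i).card ↔
      ∃ j : Fin s, (j : ℕ) = k ∧ A.orderEmbOfFin hA j ≤ i := by
  have himg : A.filter (fun a => a ≤ i) =
      (Finset.univ.filter fun j => A.orderEmbOfFin hA j ≤ i).map
        (A.orderEmbOfFin hA).toEmbedding := by
    conv_lhs => rw [← Finset.map_orderEmbOfFin_univ A hA, Finset.filter_map]
    rfl
  rw [himg, Finset.card_map]
  constructor
  · intro h
    have hk : k < s := h.trans_le ((Finset.card_le_univ _).trans_eq (Fintype.card_fin s))
    refine ⟨⟨k, hk⟩, rfl, ?_⟩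
    by_contra hlt
    refine h.not_ge ?_
    refine le_of_le_of_eq ?_ (Fin.card_Iio (⟨k, hk⟩ : Fin s))
    refine Finset.card_le_card fun j hj => Finset.mem_Iio.2 ?_
    rw [Finset.mem_filter] at hj
    by_contra hkj
    exact hlt (((A.orderEmbOfFin hA).monotone (not_lt.1 hkj)).trans hj.2)
  · rintro ⟨j, rfl, hj⟩
    rw [Nat.lt_iff_add_one_le, ← Fin.card_Iic j]
    refine Finset.card_le_card fun l hl => ?_
    simp only [Finset.mem_filter, Finset.mem_univ, true_and]
    exact ((A.orderEmbOfFin hA).monotone (Finset.mem_Iic.1 hl)).trans hj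

theorem finset_eq_of_card_filter_le_eq {d : ℕ} {A B : Finset (Fin d)}
    (h : ∀ i, (A.filter fun a => a ≤ i).card = (B.filter fun a => a ≤ i).card) : A = B := by
  have hlt : ∀ (C : Finset (Fin d)) (i : Fin d), (C.filter fun a => a ≤ i).card =
      (C.filter fun a => a < i).card + if i ∈ C then 1 else 0 := by
    intro C i
    split_ifs with hi
    · rw [← Finset.card_insert_of_notMem (a := i) (by simp)]
      congr 1
      ext a
      simp only [Finset.mem_filter, Finset.mem_insert, le_iff_lt_or_eq]
      constructor
      · rintro ⟨h, h | h⟩ <;> tauto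
      · rintro (rfl | h) <;> tauto
    · rw [add_zero]
      congr 1
      refine Finset.filter_congr fun a ha => ⟨fun h => h.lt_of_ne ?_, le_of_lt⟩
      rintro rfl
      exact hi ha
  have hlt' : ∀ i : Fin d, (A.filter fun a => a < i).card = (B.filter fun a => a < i).card := by
    intro i
    rcases Nat.eq_zero_or_pos i with h0 | h0
    · have : ∀ a : Fin d, ¬a < i := fun a ha => by
        have : (a : ℕ) < i := ha
        omega
      simp [this]
    · have hiff : ∀ a : Fin d, a < i ↔ a ≤ ⟨i - 1, by omega⟩ := fun a => by
        rw [Fin.lt_def, Fin.le_def]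
        dsimp only
        omega
      simp only [hiff]
      exact h _
  ext i
  have h1 := h i
  rw [hlt, hlt, hlt' i] at h1
  by_cases hA : i ∈ A <;> by_cases hB : i ∈ B <;> simp_all

variable {m n t : ℕ}

namespace MinorIndex

theorem card_rows_filter_le_of_precedes {p q : MinorIndex m n} (h : p.Precedes q) (i : Fin m) :
    (q.1.1.filter fun a => a ≤ i).card ≤ (p.1.1.filter fun a => a ≤ i).card := by
  rcases Nat.eq_zero_or_pos n with rfl | hn
  · have : q.1.1.card = 0 := by rw [← q.2, Finset.eq_empty_of_isEmpty q.1.2, Finset.card_empty]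
    simp [Finset.card_eq_zero.1 this]
  have key : ∀ x : MinorIndex m n,
      x.rank (n + m - 2 - i) + (i + 1) = m + (x.1.1.filter fun a => a ≤ i).card := by
    intro x
    have h1 : (x.columns.filter fun c => pos c ≤ n + m - 2 - i) =
        x.1.2.disjSum (x.1.1ᶜ.filter fun a => ¬a ≤ i) := by
      ext c
      have := i.2
      rw [Finset.mem_filter]
      rcases c with c | c
      · have := c.2
        simp [columns, pos]
        omega
      · have := c.2
        simp [columns, pos]
        rw [Fin.lt_def]
        omega
    have h2 := Finset.card_filter_add_card_filter_not (s := x.1.1ᶜ) fun a => a ≤ i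
    have h3 : (x.1.1.filter fun a => a ≤ i).card + (x.1.1ᶜ.filter fun a => a ≤ i).card =
        i + 1 := by
      rw [← Fin.card_Iic i, ← Finset.card_union_of_disjoint, ← Finset.filter_union]
      · congr 1
        ext
        simp
      · exact Finset.disjoint_filter_filter disjoint_compl_right
    have h4 := Finset.card_add_card_compl x.1.1
    have h5 := x.2
    rw [Fintype.card_fin] at h4
    rw [rank, h1, Finset.card_disjSum]
    omega
  have h1 := key p
  have h2 := key q
  have h3 := h (n + m - 2 - i)
  omega

theorem card_cols_filter_le_of_precedes {p q : MinorIndex m n} (h : p.Precedes q) (j : Fin n) :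
    (q.1.2.filter fun a => a ≤ j).card ≤ (p.1.2.filter fun a => a ≤ j).card := by
  have key : ∀ x : MinorIndex m n, x.rank j = (x.1.2.filter fun a => a ≤ j).card := by
    intro x
    have : (x.columns.filter fun c => pos c ≤ j) =
        (x.1.2.filter fun a => a ≤ j).map Function.Embedding.inl := by
      ext c
      rw [Finset.mem_filter]
      rcases c with c | c
      · simp [columns, pos]
      · have := j.2
        simp [columns, pos]
        omega
    rw [rank, this, Finset.card_map]
  rw [← key, ← key]
  exact h j

theorem Precedes.refl (p : MinorIndex m n) : p.Precedes p := fun _ => le_rfl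

theorem Precedes.trans {p q r : MinorIndex m n} (h : p.Precedes q) (h' : q.Precedes r) :
    p.Precedes r := fun l => (h' l).trans (h l)

end MinorIndex

theorem MinorIndex.IsStandard.exists_precedes {T : Multiset (MinorIndex m n)} (hT : MinorIndex.IsStandard T)
    (h0 : T ≠ 0) : ∃ p ∈ T, ∀ q ∈ T, p.Precedes q := by
  induction T using Multiset.induction with
  | empty => exact absurd rfl h0
  | cons a T ih =>
    rcases eq_or_ne T 0 with rfl | hT0
    · exact ⟨a, by simp, by simpa using MinorIndex.Precedes.refl a⟩
    · obtain ⟨p, hp, hpq⟩ := ih (fun p hp q hq => hT p (Multiset.mem_cons_of_mem hp) q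
        (Multiset.mem_cons_of_mem hq)) hT0
      rcases hT a (by simp) p (by simp [hp]) with h | h
      · refine ⟨a, by simp, fun q hq => ?_⟩
        rcases Multiset.mem_cons.1 hq with rfl | hq
        · exact MinorIndex.Precedes.refl _
        · exact h.trans (hpq q hq)
      · refine ⟨p, by simp [hp], fun q hq => ?_⟩
        rcases Multiset.mem_cons.1 hq with rfl | hq
        · exact h
        · exact hpq q hq

theorem pathExponent_inl_ne_zero_iff {s : ℕ} (r : Fin s → Fin m) (c : Fin s → Fin n)
    (f : Fin s → Fin t) (a : Fin m) (k : Fin t) :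
    pathExponent r c f (Sum.inl (a, k)) ≠ 0 ↔ ∃ i, r i = a ∧ f i = k := by
  classical
  simp [pathExponent, Finsupp.finsetSum_apply, Finsupp.single_apply]

theorem pathExponent_inr_ne_zero_iff {s : ℕ} (r : Fin s → Fin m) (c : Fin s → Fin n)
    (f : Fin s → Fin t) (b : Fin n) (k : Fin t) :
    pathExponent r c f (Sum.inr (k, b)) ≠ 0 ↔ ∃ i, f i = k ∧ c i = b := by
  classical
  simp [pathExponent, Finsupp.finsetSum_apply, Finsupp.single_apply]

/-- The index set of the nonempty minors of size at most `t`. -/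
abbrev SmallMinorIndex (m n t : ℕ) :=
  {p : MinorIndex m n // 0 < p.1.1.card ∧ p.1.1.card ≤ t}

namespace SmallMinorIndex

/-- The exponent of the least term of a minor of `genericMul`. -/
noncomputable def exponent (p : SmallMinorIndex m n t) :
    (Fin m × Fin t) ⊕ (Fin t × Fin n) →₀ ℕ :=
  pathExponent (p.1.1.1.orderEmbOfFin rfl) (p.1.1.2.orderEmbOfFin p.1.2) (Fin.castLE p.2.2)

theorem exists_exponent_inl_ne_zero_iff (p : SmallMinorIndex m n t) (i : Fin m) (k : Fin t) :
    (∃ a ≤ i, p.exponent (Sum.inl (a, k)) ≠ 0) ↔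
      (k : ℕ) < (p.1.1.1.filter fun a => a ≤ i).card := by
  simp_rw [lt_card_filter_le_iff _ rfl, exponent, pathExponent_inl_ne_zero_iff]
  constructor
  · rintro ⟨a, ha, j, rfl, rfl⟩
    exact ⟨j, rfl, ha⟩
  · rintro ⟨j, hj, ha⟩
    exact ⟨_, ha, j, rfl, Fin.ext hj⟩

theorem exists_exponent_inr_ne_zero_iff (p : SmallMinorIndex m n t) (i : Fin n) (k : Fin t) :
    (∃ a ≤ i, p.exponent (Sum.inr (k, a)) ≠ 0) ↔
      (k : ℕ) < (p.1.1.2.filter fun a => a ≤ i).card := by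
  simp_rw [lt_card_filter_le_iff _ p.1.2, exponent, pathExponent_inr_ne_zero_iff]
  constructor
  · rintro ⟨a, ha, j, rfl, rfl⟩
    exact ⟨j, rfl, ha⟩
  · rintro ⟨j, hj, ha⟩
    exact ⟨_, ha, j, Fin.ext hj, rfl⟩

theorem exponent_ne_zero (p : SmallMinorIndex m n t) : p.exponent ≠ 0 := by
  intro h
  have : p.exponent (Sum.inl (p.1.1.1.orderEmbOfFin rfl ⟨0, p.2.1⟩,
      Fin.castLE p.2.2 ⟨0, p.2.1⟩)) ≠ 0 :=
    (pathExponent_inl_ne_zero_iff ..).2 ⟨_, rfl, rfl⟩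
  rw [h] at this
  exact this rfl

end SmallMinorIndex

theorem multiset_sum_apply_ne_zero_iff {ι σ : Type*} (T : Multiset ι) (f : ι → σ →₀ ℕ) (x : σ) :
    (T.map f).sum x ≠ 0 ↔ ∃ p ∈ T, f p x ≠ 0 := by
  induction T using Multiset.induction with
  | empty => simp
  | cons a T ih =>
    simp only [Multiset.map_cons, Multiset.sum_cons, Finsupp.add_apply, Multiset.mem_cons,
      exists_eq_or_imp, ← ih]
    omega

namespace SmallMinorIndex

theorem exists_sum_exponent_inl_ne_zero_iff {T : Multiset (SmallMinorIndex m n t)}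
    {p : SmallMinorIndex m n t} (hp : p ∈ T) (hT : ∀ q ∈ T, p.1.Precedes q.1) (i : Fin m)
    (k : Fin t) : (∃ a ≤ i, (T.map exponent).sum (Sum.inl (a, k)) ≠ 0) ↔
      (k : ℕ) < (p.1.1.1.filter fun a => a ≤ i).card := by
  simp_rw [multiset_sum_apply_ne_zero_iff]
  constructor
  · rintro ⟨a, ha, q, hq, h⟩
    exact ((exists_exponent_inl_ne_zero_iff q i k).1 ⟨a, ha, h⟩).trans_le
      (MinorIndex.card_rows_filter_le_of_precedes (hT q hq) i)
  · intro h
    obtain ⟨a, ha, h⟩ := (exists_exponent_inl_ne_zero_iff p i k).2 h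
    exact ⟨a, ha, p, hp, h⟩

theorem exists_sum_exponent_inr_ne_zero_iff {T : Multiset (SmallMinorIndex m n t)}
    {p : SmallMinorIndex m n t} (hp : p ∈ T) (hT : ∀ q ∈ T, p.1.Precedes q.1) (i : Fin n)
    (k : Fin t) : (∃ a ≤ i, (T.map exponent).sum (Sum.inr (k, a)) ≠ 0) ↔
      (k : ℕ) < (p.1.1.2.filter fun a => a ≤ i).card := by
  simp_rw [multiset_sum_apply_ne_zero_iff]
  constructor
  · rintro ⟨a, ha, q, hq, h⟩
    exact ((exists_exponent_inr_ne_zero_iff q i k).1 ⟨a, ha, h⟩).trans_le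
      (MinorIndex.card_cols_filter_le_of_precedes (hT q hq) i)
  · intro h
    obtain ⟨a, ha, h⟩ := (exists_exponent_inr_ne_zero_iff p i k).2 h
    exact ⟨a, ha, p, hp, h⟩

theorem eq_of_sum_exponent_eq {T T' : Multiset (SmallMinorIndex m n t)}
    {p p' : SmallMinorIndex m n t} (hp : p ∈ T) (hT : ∀ q ∈ T, p.1.Precedes q.1) (hp' : p' ∈ T')
    (hT' : ∀ q ∈ T', p'.1.Precedes q.1)
    (h : (T.map exponent).sum = (T'.map exponent).sum) : p = p' := by
  have eq_of_lt_iff : ∀ a b : ℕ, a ≤ t → b ≤ t → (∀ k : Fin t, (k : ℕ) < a ↔ (k : ℕ) < b) →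
      a = b := by
    intro a b ha hb hab
    rcases lt_trichotomy a b with hlt | he | hlt
    · exact absurd ((hab ⟨a, by omega⟩).2 hlt) (lt_irrefl a)
    · exact he
    · exact absurd ((hab ⟨b, by omega⟩).1 hlt) (lt_irrefl b)
  refine Subtype.ext (Subtype.ext (Prod.ext ?_ ?_))
  · refine finset_eq_of_card_filter_le_eq fun i => eq_of_lt_iff _ _
      ((Finset.card_filter_le _ _).trans p.2.2) ((Finset.card_filter_le _ _).trans p'.2.2)
      fun k => ?_
    rw [← exists_sum_exponent_inl_ne_zero_iff hp hT, ← exists_sum_exponent_inl_ne_zero_iff hp' hT',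
      h]
  · refine finset_eq_of_card_filter_le_eq fun i => eq_of_lt_iff _ _
      ((Finset.card_filter_le _ _).trans (p.1.2.trans_le p.2.2))
      ((Finset.card_filter_le _ _).trans (p'.1.2.trans_le p'.2.2)) fun k => ?_
    rw [← exists_sum_exponent_inr_ne_zero_iff hp hT, ← exists_sum_exponent_inr_ne_zero_iff hp' hT',
      h]

theorem exists_precedes {T : Multiset (SmallMinorIndex m n t)}
    (hT : MinorIndex.IsStandard (T.map Subtype.val)) (h0 : T ≠ 0) :
    ∃ p ∈ T, ∀ q ∈ T, p.1.Precedes q.1 := by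
  obtain ⟨p, hp, h⟩ := hT.exists_precedes (by simpa using h0)
  obtain ⟨p, hp', rfl⟩ := Multiset.mem_map.1 hp
  exact ⟨p, hp', fun q hq => h _ (Multiset.mem_map_of_mem _ hq)⟩

theorem sum_exponent_injOn : Set.InjOn
    (fun T : Multiset (SmallMinorIndex m n t) => (T.map exponent).sum)
    {T | MinorIndex.IsStandard (T.map Subtype.val)} := by
  have eq_zero : ∀ T : Multiset (SmallMinorIndex m n t), (T.map exponent).sum = 0 → T = 0 := by
    intro T h
    by_contra h0
    obtain ⟨p, hp⟩ := Multiset.exists_mem_of_ne_zero h0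
    obtain ⟨x, hx⟩ := Finsupp.ne_iff.1 p.exponent_ne_zero
    exact (multiset_sum_apply_ne_zero_iff T exponent x).2 ⟨p, hp, hx⟩ (by rw [h]; rfl)
  intro T
  induction hc : T.card generalizing T with
  | zero =>
    intro _ T' _ h
    rw [Multiset.card_eq_zero.1 hc] at h ⊢
    exact (eq_zero T' h.symm).symm
  | succ d ih =>
    intro hT T' hT' h
    have h0 : T ≠ 0 := fun h => by simp [h] at hc
    have h0' : T' ≠ 0 := by
      rintro rfl
      exact h0 (eq_zero T h)
    obtain ⟨p, hp, hmin⟩ := exists_precedes hT h0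
    obtain ⟨p', hp', hmin'⟩ := exists_precedes hT' h0'
    obtain rfl := eq_of_sum_exponent_eq hp hmin hp' hmin' h
    obtain ⟨T, rfl⟩ := Multiset.exists_cons_of_mem hp
    obtain ⟨T', rfl⟩ := Multiset.exists_cons_of_mem hp'
    have of_cons : ∀ U : Multiset (SmallMinorIndex m n t),
        MinorIndex.IsStandard ((p ::ₘ U).map Subtype.val) →
          MinorIndex.IsStandard (U.map Subtype.val) := fun U hU a ha b hb =>
      hU a (by simp [ha]) b (by simp [hb])
    simp only [Multiset.map_cons, Multiset.sum_cons] at h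
    rw [ih (by simpa using hc) (of_cons T hT) (of_cons T' hT') (add_left_cancel h)]

end SmallMinorIndex

end Decoding

section Kernel

variable {m n t : ℕ} {R : Type*} [CommRing R]

/-- The generic `m × n` matrix. -/
noncomputable def genericMatrix (m n : ℕ) (R : Type*) [CommRing R] :
    Matrix (Fin m) (Fin n) (MvPolynomial (Fin m × Fin n) R) :=
  Matrix.of fun i j => X (i, j)

namespace MinorIndex

theorem minor_eq_one {x : Matrix (Fin m) (Fin n) R} {p : MinorIndex m n} (hp : p.1.1.card = 0) :
    p.minor x = 1 := by
  have : IsEmpty (Fin p.1.1.card) := by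
    rw [hp]
    infer_instance
  exact Matrix.det_isEmpty

theorem exists_minor_eq (x : Matrix (Fin m) (Fin n) R) (i : Fin m) (j : Fin n) :
    ∃ p : MinorIndex m n, p.minor x = x i j := by
  refine ⟨⟨({i}, {j}), by simp⟩, ?_⟩
  have : Unique (Fin ({i} : Finset (Fin m)).card) := by
    rw [Finset.card_singleton]
    infer_instance
  rw [minor, Matrix.det_unique, Matrix.submatrix_apply]
  congr 1
  · exact Finset.mem_singleton.1 (Finset.orderEmbOfFin_mem _ _ _)
  · exact Finset.mem_singleton.1 (Finset.orderEmbOfFin_mem _ _ _)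

theorem map_minor {S F : Type*} [CommRing S] [FunLike F R S] [RingHomClass F R S] (φ : F)
    (x : Matrix (Fin m) (Fin n) R) (p : MinorIndex m n) :
    φ (p.minor x) = p.minor (x.map φ) := by
  rw [minor, minor, Matrix.submatrix_map]
  exact RingHom.map_det (φ : R →+* S) _

theorem mem_span_prod_minor (f : MvPolynomial (Fin m × Fin n) R) :
    f ∈ Submodule.span R {z | ∃ T : Multiset (MinorIndex m n), IsStandard T ∧
      (∀ p ∈ T, 0 < p.1.1.card) ∧ z = (T.map (minor (genericMatrix m n R))).prod} := by
  set x := genericMatrix m n R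
  set V := Submodule.span R {z | ∃ T : Multiset (MinorIndex m n), IsStandard T ∧
      (∀ p ∈ T, 0 < p.1.1.card) ∧ z = (T.map (minor x)).prod}
  have hV : ∀ T : Multiset (MinorIndex m n), (T.map (minor x)).prod ∈ V := by
    intro T
    have hle : Submodule.span ℤ {z | ∃ T' : Multiset (MinorIndex m n),
        IsStandard T' ∧ z = (T'.map (minor x)).prod} ≤ V.restrictScalars ℤ := by
      rw [Submodule.span_le]
      rintro _ ⟨T, hT, rfl⟩
      refine Submodule.subset_span ⟨T.filter fun p => 0 < p.1.1.card,
        fun p hp q hq => hT p (Multiset.mem_of_mem_filter hp) q (Multiset.mem_of_mem_filter hq),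
        fun p hp => (Multiset.mem_filter.1 hp).2, ?_⟩
      conv_lhs => rw [← Multiset.filter_add_not (fun p => 0 < p.1.1.card) T, Multiset.map_add,
        Multiset.prod_add]
      rw [Multiset.prod_eq_one (s := (T.filter fun p => ¬0 < p.1.1.card).map _) fun z hz => ?_,
        mul_one]
      obtain ⟨p, hp, rfl⟩ := Multiset.mem_map.1 hz
      exact minor_eq_one (Nat.eq_zero_of_not_pos (Multiset.mem_filter.1 hp).2)
    exact hle (prod_minor_mem_span x T)
  have hspan : f ∈ Submodule.span R
      (Set.range fun T : Multiset (MinorIndex m n) => (T.map (minor x)).prod) := by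
    induction f using MvPolynomial.induction_on with
    | C a =>
      rw [← mul_one (C a), ← smul_eq_C_mul]
      exact Submodule.smul_mem _ _ (Submodule.subset_span ⟨0, by simp⟩)
    | add f g hf hg => exact add_mem hf hg
    | mul_X f i hf =>
      obtain ⟨p, hp⟩ := exists_minor_eq x i.1 i.2
      induction hf using Submodule.span_induction with
      | mem g hg =>
        obtain ⟨T, rfl⟩ := hg
        refine Submodule.subset_span ⟨p ::ₘ T, ?_⟩
        simp only [Multiset.map_cons, Multiset.prod_cons, hp]
        rw [mul_comm]
        rfl
      | zero => simp
      | add g h _ _ hg hh => rw [add_mul]; exact add_mem hg hh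
      | smul a g _ hg => rw [smul_mul_assoc]; exact Submodule.smul_mem _ _ hg
  refine Submodule.span_le.2 ?_ hspan
  rintro _ ⟨T, rfl⟩
  exact hV T

end MinorIndex

/-- The ideal generated by the minors of size `s` of the generic `m × n` matrix. -/
noncomputable def determinantalIdeal (m n s : ℕ) (R : Type*) [CommRing R] :
    Ideal (MvPolynomial (Fin m × Fin n) R) :=
  Ideal.span {f | ∃ (r : Fin s → Fin m) (c : Fin s → Fin n),
    Function.Injective r ∧ Function.Injective c ∧ f = ((genericMatrix m n R).submatrix r c).det}

theorem det_submatrix_mem_determinantalIdeal {s s' : ℕ} (h : s ≤ s') (r : Fin s' → Fin m)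
    (c : Fin s' → Fin n) (hr : Function.Injective r) (hc : Function.Injective c) :
    ((genericMatrix m n R).submatrix r c).det ∈ determinantalIdeal m n s R := by
  induction s', h using Nat.le_induction with
  | base => exact Ideal.subset_span ⟨r, c, hr, hc, rfl⟩
  | succ d _ ih =>
    rw [Matrix.det_succ_row_zero]
    refine Ideal.sum_mem _ fun j _ => Ideal.mul_mem_left _ _ ?_
    rw [Matrix.submatrix_submatrix]
    exact ih _ _ (hr.comp (Fin.succ_injective d)) (hc.comp Fin.succAbove_right_injective)

/-- The algebra morphism induced by matrix multiplication. -/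
noncomputable def mulPullback (m n t : ℕ) (R : Type*) [CommRing R] :
    MvPolynomial (Fin m × Fin n) R →ₐ[R] MvPolynomial ((Fin m × Fin t) ⊕ (Fin t × Fin n)) R :=
  aeval fun p => ∑ k : Fin t, X (Sum.inl (p.1, k)) * X (Sum.inr (k, p.2))

theorem map_mulPullback_genericMatrix :
    (genericMatrix m n R).map (mulPullback m n t R) = genericMul m n t R := by
  ext1 i j
  simp [genericMatrix, mulPullback, genericMul]

theorem determinantalIdeal_le_ker :
    determinantalIdeal m n (t + 1) R ≤ RingHom.ker (mulPullback m n t R) := by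
  rw [determinantalIdeal, Ideal.span_le]
  rintro _ ⟨r, c, -, -, rfl⟩
  rw [SetLike.mem_coe, RingHom.mem_ker, AlgHom.map_det, AlgHom.mapMatrix_apply,
    ← Matrix.submatrix_map, map_mulPullback_genericMatrix]
  exact det_genericMul_submatrix_eq_zero (Nat.lt_succ_self t) r c

theorem linearIndependent_prod_minor_genericMul :
    LinearIndependent R fun T : {T : Multiset (SmallMinorIndex m n t) //
      MinorIndex.IsStandard (T.map Subtype.val)} =>
        (T.1.map fun p => p.1.minor (genericMul m n t R)).prod := by
  refine HasLeastTerm.linearIndependent (w := pathWeight m n t) _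
    (fun T => (T.1.map SmallMinorIndex.exponent).sum) (fun T => ?_)
    (fun T T' h => Subtype.ext (SmallMinorIndex.sum_exponent_injOn T.2 T'.2 h))
  exact HasLeastTerm.multiset_prod _ _ (fun p => hasLeastTerm_det_genericMul p.2.2 _ _
    (OrderEmbedding.strictMono _) (OrderEmbedding.strictMono _)) _

theorem ker_mulPullback :
    RingHom.ker (mulPullback m n t R) = determinantalIdeal m n (t + 1) R := by
  refine le_antisymm (fun f hf => ?_) determinantalIdeal_le_ker
  let F : {T : Multiset (SmallMinorIndex m n t) // MinorIndex.IsStandard (T.map Subtype.val)} →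
    MvPolynomial (Fin m × Fin n) R := fun T =>
      (T.1.map fun p => p.1.minor (genericMatrix m n R)).prod
  have hF : LinearIndependent R ((mulPullback m n t R).toLinearMap ∘ F) := by
    convert linearIndependent_prod_minor_genericMul (m := m) (n := n) (t := t) (R := R) using 2
      with T
    simp only [Function.comp_apply, F, AlgHom.toLinearMap_apply, map_multiset_prod,
      Multiset.map_map]
    refine congrArg _ (Multiset.map_congr rfl fun p _ => ?_)
    simp only [MinorIndex.map_minor, map_mulPullback_genericMatrix]
  have hle : Submodule.span R {z | ∃ T : Multiset (MinorIndex m n), MinorIndex.IsStandard T ∧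
      (∀ p ∈ T, 0 < p.1.1.card) ∧ z = (T.map (MinorIndex.minor (genericMatrix m n R))).prod} ≤
      Submodule.span R (Set.range F) ⊔
        (determinantalIdeal m n (t + 1) R).restrictScalars R := by
    rw [Submodule.span_le]
    rintro _ ⟨T, hT, hpos, rfl⟩
    by_cases hsmall : ∀ p ∈ T, p.1.1.card ≤ t
    · lift T to Multiset (SmallMinorIndex m n t) using fun p hp => ⟨hpos p hp, hsmall p hp⟩
      refine Submodule.mem_sup_left (Submodule.subset_span ⟨⟨T, hT⟩, ?_⟩)
      simp [F, Multiset.map_map]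
    · push Not at hsmall
      obtain ⟨p, hp, hlt⟩ := hsmall
      obtain ⟨T, rfl⟩ := Multiset.exists_cons_of_mem hp
      refine Submodule.mem_sup_right ?_
      rw [Multiset.map_cons, Multiset.prod_cons]
      exact Ideal.mul_mem_right _ _ (det_submatrix_mem_determinantalIdeal hlt _ _
        (RelEmbedding.injective _) (RelEmbedding.injective _))
  obtain ⟨g, hg, h, hh, rfl⟩ := Submodule.mem_sup.1 (hle (MinorIndex.mem_span_prod_minor f))
  have hh' : mulPullback m n t R h = 0 := determinantalIdeal_le_ker hh
  have hg' : mulPullback m n t R g = 0 := by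
    have : mulPullback m n t R (g + h) = 0 := hf
    rwa [map_add, hh', add_zero] at this
  have : g = 0 := Submodule.disjoint_def.1 (Submodule.range_ker_disjoint hF) g hg hg'
  rw [this, zero_add]
  exact hh

theorem determinantalIdeal_eq_bot {s : ℕ} (h : min m n < s) :
    determinantalIdeal m n s R = ⊥ := by
  rw [determinantalIdeal, Ideal.span_eq_bot]
  rintro _ ⟨r, c, hr, hc, -⟩
  have h1 := Fintype.card_le_of_injective r hr
  have h2 := Fintype.card_le_of_injective c hc
  simp only [Fintype.card_fin] at h1 h2
  omega

end Kernel

/-- **Second fundamental theorem of invariant theory for `GLₜ`.**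
The kernel of the algebra morphism `θ* : K[X_{ij}] → K[Y_{ik}, Z_{kj}]`,
`X_{ij} ↦ ∑ₖ Y_{ik} Z_{kj}` (induced by matrix multiplication), is the ideal generated by the
`(t+1) × (t+1)` minors of the generic `m × n` matrix `(X_{ij})`; in particular the kernel is
zero when `t ≥ min m n`. -/
theorem second_fundamental_theorem_GL
    (K : Type*) [Field K] (m n t : ℕ) (hm : 0 < m) (hn : 0 < n) (ht : 0 < t) :
    RingHom.ker (MvPolynomial.aeval
        (fun p : Fin m × Fin n =>
          ∑ k : Fin t,
            (X (Sum.inl (p.1, k)) : MvPolynomial ((Fin m × Fin t) ⊕ (Fin t × Fin n)) K) *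
              X (Sum.inr (k, p.2))) :
        MvPolynomial (Fin m × Fin n) K →ₐ[K] MvPolynomial ((Fin m × Fin t) ⊕ (Fin t × Fin n)) K)
      = Ideal.span {f : MvPolynomial (Fin m × Fin n) K |
          ∃ (r : Fin (t + 1) → Fin m) (c : Fin (t + 1) → Fin n),
            Function.Injective r ∧ Function.Injective c ∧
              f = (Matrix.of fun a b : Fin (t + 1) =>
                    (X (r a, c b) : MvPolynomial (Fin m × Fin n) K)).det} ∧
    (min m n ≤ t →
      RingHom.ker (MvPolynomial.aeval
        (fun p : Fin m × Fin n =>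
          ∑ k : Fin t,
            (X (Sum.inl (p.1, k)) : MvPolynomial ((Fin m × Fin t) ⊕ (Fin t × Fin n)) K) *
              X (Sum.inr (k, p.2))) :
        MvPolynomial (Fin m × Fin n) K →ₐ[K] MvPolynomial ((Fin m × Fin t) ⊕ (Fin t × Fin n)) K)
      = ⊥) := by
  exact ⟨ker_mulPullback, fun h => ker_mulPullback.trans
    (determinantalIdeal_eq_bot (Nat.lt_succ_of_le h))⟩
end

section
/- For every field K and all positive integers m, n, t, the algebra morphism θ : A(m,n) → A(m,t) ⊗_K A(t,n) determined by θ(x_{ij}) = Σ_{k=1}^t y_{ik} ⊗ z_{kj} is injective. -/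
open TensorProduct

/-- The monoid morphism sending a word in pairs to its pair of coordinate words. -/
def FreeMonoid.unzip (α β : Type*) : FreeMonoid (α × β) →* FreeMonoid α × FreeMonoid β :=
  (FreeMonoid.map Prod.fst).prod (FreeMonoid.map Prod.snd)

theorem FreeMonoid.unzip_injective (α β : Type*) :
    Function.Injective (FreeMonoid.unzip α β) := by
  intro a b h
  have h₁ : a.toList.map Prod.fst = b.toList.map Prod.fst :=
    congrArg (fun p => FreeMonoid.toList p.1) h
  have h₂ : a.toList.map Prod.snd = b.toList.map Prod.snd :=
    congrArg (fun p => FreeMonoid.toList p.2) h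
  apply FreeMonoid.toList.injective
  rw [← List.zip_unzip a.toList, ← List.zip_unzip b.toList]
  simp only [List.unzip_eq_map, h₁, h₂]

/-- Images of two free algebras commute as soon as the images of the generators do. -/
theorem FreeAlgebra.commute_lift {R A X Y : Type*} [CommSemiring R] [Semiring A] [Algebra R A]
    {f : X → A} {g : Y → A} (h : ∀ x y, Commute (f x) (g y))
    (a : FreeAlgebra R X) (b : FreeAlgebra R Y) :
    Commute (FreeAlgebra.lift R f a) (FreeAlgebra.lift R g b) := by
  induction a using FreeAlgebra.induction with
  | grade0 r => simpa using Algebra.commute_algebraMap_left r _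
  | mul a₁ a₂ h₁ h₂ => simpa using h₁.mul_left h₂
  | add a₁ a₂ h₁ h₂ => simpa using h₁.add_left h₂
  | grade1 x =>
    induction b using FreeAlgebra.induction with
    | grade0 r => simpa using Algebra.commute_algebraMap_right r _
    | mul b₁ b₂ h₁ h₂ => simpa using h₁.mul_right h₂
    | add b₁ b₂ h₁ h₂ => simpa using h₁.add_right h₂
    | grade1 y => simpa using h x y

/-- For any field `K` and positive integers `m, n, t`, the algebra morphism
`θ : A(m,n) → A(m,t) ⊗ A(t,n)` between free algebras determined by
`θ(x_{ij}) = ∑ₖ y_{ik} ⊗ z_{kj}` is injective. -/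
theorem free_theta_injective (K : Type*) [Field K] (m n t : ℕ)
    (hm : 0 < m) (hn : 0 < n) (ht : 0 < t) :
    Function.Injective
      (FreeAlgebra.lift K
        (fun p : Fin m × Fin n =>
          ∑ k : Fin t,
            FreeAlgebra.ι K ((p.1, k) : Fin m × Fin t) ⊗ₜ[K]
              FreeAlgebra.ι K ((k, p.2) : Fin t × Fin n) :
          Fin m × Fin n → FreeAlgebra K (Fin m × Fin t) ⊗[K] FreeAlgebra K (Fin t × Fin n))) := by
  let k₀ : Fin t := ⟨0, ht⟩
  let M := FreeMonoid (Fin m) × FreeMonoid (Fin n)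
  let f : Fin m × Fin t → MonoidAlgebra K M := fun p =>
    if p.2 = k₀ then MonoidAlgebra.of K M (FreeMonoid.of p.1, 1) else 0
  let g : Fin t × Fin n → MonoidAlgebra K M := fun p =>
    if p.1 = k₀ then MonoidAlgebra.of K M (1, FreeMonoid.of p.2) else 0
  have hfg : ∀ x y, Commute (f x) (g y) := by
    intro x y
    simp only [f, g]
    split_ifs
    · rw [commute_iff_eq, ← map_mul, ← map_mul]
      exact congrArg _ (Prod.ext rfl rfl)
    all_goals simp
  let φ := Algebra.TensorProduct.lift (FreeAlgebra.lift K f) (FreeAlgebra.lift K g)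
    (FreeAlgebra.commute_lift hfg)
  let ψ : FreeAlgebra K (Fin m × Fin n) →ₐ[K] MonoidAlgebra K M :=
    (MonoidAlgebra.mapDomainAlgHom K K (FreeMonoid.unzip (Fin m) (Fin n))).comp
      (FreeAlgebra.equivMonoidAlgebraFreeMonoid (R := K)).toAlgHom
  have hψ : Function.Injective ψ :=
    (MonoidAlgebra.mapDomain_injective (FreeMonoid.unzip_injective _ _)).comp
      (FreeAlgebra.equivMonoidAlgebraFreeMonoid (R := K)).injective
  refine Function.Injective.of_comp (f := φ) ?_
  rw [← AlgHom.coe_comp]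
  convert hψ using 2
  ext ⟨i, j⟩ : 2
  have hg : f (i, k₀) * g (k₀, j) = MonoidAlgebra.of K M (FreeMonoid.of i, FreeMonoid.of j) := by
    simp only [f, g, if_true, ← map_mul]
    exact congrArg _ (Prod.ext rfl rfl)
  have hsum : ∑ k, f (i, k) * g (k, j) = f (i, k₀) * g (k₀, j) :=
    Finset.sum_eq_single k₀ (fun k _ hk => by simp [f, hk]) (by simp)
  simp [φ, ψ, hsum, hg, FreeAlgebra.equivMonoidAlgebraFreeMonoid, FreeMonoid.unzip]
end

section
/- The set of coinvariants (A ⊗ B)^{coH} = {x ∈ A ⊗ B : α(x) = 1 ⊗ x} is a unital subalgebra of A ⊗ B: it contains 1 ⊗ 1 and is closed under addition, scalar multiplication and multiplication. -/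
open TensorProduct

variable (K : Type*) [Field K] (H : Type*) [Ring H] [HopfAlgebra K H]

/-- `ρ : A → A ⊗ H` is a right `H`-coaction: it is coassociative and counital. -/
def IsRightCoaction {A : Type*} [AddCommGroup A] [Module K A]
    (ρ : A →ₗ[K] A ⊗[K] H) : Prop :=
  ((TensorProduct.assoc K A H H).toLinearMap ∘ₗ
      TensorProduct.map ρ LinearMap.id ∘ₗ ρ =
    TensorProduct.map LinearMap.id (Coalgebra.comul (R := K)) ∘ₗ ρ) ∧
  ((TensorProduct.rid K A).toLinearMap ∘ₗ
      TensorProduct.map LinearMap.id (Coalgebra.counit (R := K)) ∘ₗ ρ = LinearMap.id)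

/-- `λ : B → H ⊗ B` is a left `H`-coaction: it is coassociative and counital. -/
def IsLeftCoaction {B : Type*} [AddCommGroup B] [Module K B]
    (lam : B →ₗ[K] H ⊗[K] B) : Prop :=
  (TensorProduct.map LinearMap.id lam ∘ₗ lam =
    (TensorProduct.assoc K H H B).toLinearMap ∘ₗ
      TensorProduct.map (Coalgebra.comul (R := K)) LinearMap.id ∘ₗ lam) ∧
  ((TensorProduct.lid K B).toLinearMap ∘ₗ
      TensorProduct.map (Coalgebra.counit (R := K)) LinearMap.id ∘ₗ lam = LinearMap.id)

/-- The left coaction `ρ' = τ ∘ (id ⊗ S) ∘ ρ` associated to a right coaction `ρ`. -/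
noncomputable def leftCoactionOfRight {A : Type*} [AddCommGroup A] [Module K A]
    (ρ : A →ₗ[K] A ⊗[K] H) : A →ₗ[K] H ⊗[K] A :=
  (TensorProduct.comm K A H).toLinearMap ∘ₗ
    LinearMap.lTensor A (HopfAlgebra.antipode (R := K)) ∘ₗ ρ

/-- The tensor product coaction on `A ⊗ B`:
`a ⊗ b ↦ Σ a₍₋₁₎ b₍₋₁₎ ⊗ a₍₀₎ ⊗ b₍₀₎`. -/
noncomputable def tensorCoaction {A B : Type*} [AddCommGroup A] [Module K A]
    [AddCommGroup B] [Module K B]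
    (βA : A →ₗ[K] H ⊗[K] A) (βB : B →ₗ[K] H ⊗[K] B) :
    A ⊗[K] B →ₗ[K] H ⊗[K] (A ⊗[K] B) :=
  TensorProduct.map (LinearMap.mul' K H) LinearMap.id ∘ₗ
    (TensorProduct.tensorTensorTensorComm K H A H B).toLinearMap ∘ₗ
      TensorProduct.map βA βB

/-- The coinvariants `{x | β(x) = 1 ⊗ x}` of a left comodule. -/
def coinvariants {M : Type*} [AddCommGroup M] [Module K M]
    (β : M →ₗ[K] H ⊗[K] M) : Set M :=
  {x : M | β x = (1 : H) ⊗ₜ[K] x}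

/-- The map `(p ⊗ k) ⊗ (h ⊗ q) ↦ S(k) h ⊗ (p ⊗ q)` underlying the tensor product coaction. -/
noncomputable def antipodeTwist (A B : Type*) [Ring A] [Algebra K A] [Ring B] [Algebra K B] :
    (A ⊗[K] H) ⊗[K] (H ⊗[K] B) →ₗ[K] H ⊗[K] (A ⊗[K] B) :=
  TensorProduct.map (LinearMap.mul' K H) LinearMap.id ∘ₗ
    (TensorProduct.tensorTensorTensorComm K H A H B).toLinearMap ∘ₗ
      TensorProduct.map ((TensorProduct.comm K A H).toLinearMap ∘ₗ
        LinearMap.lTensor A (HopfAlgebra.antipode (R := K))) LinearMap.id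

@[simp]
lemma antipodeTwist_tmul {A B : Type*} [Ring A] [Algebra K A] [Ring B] [Algebra K B]
    (p : A) (k h : H) (q : B) :
    antipodeTwist K H A B ((p ⊗ₜ[K] k) ⊗ₜ[K] (h ⊗ₜ[K] q)) =
      (HopfAlgebra.antipode K k * h) ⊗ₜ[K] (p ⊗ₜ[K] q) := by
  simp [antipodeTwist]

lemma tensorCoaction_leftCoactionOfRight_tmul {A B : Type*} [Ring A] [Algebra K A]
    [Ring B] [Algebra K B] (ρ : A →ₗ[K] A ⊗[K] H) (lam : B →ₗ[K] H ⊗[K] B) (a : A) (b : B) :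
    tensorCoaction K H (leftCoactionOfRight K H ρ) lam (a ⊗ₜ[K] b) =
      antipodeTwist K H A B (ρ a ⊗ₜ[K] lam b) := by
  simp [tensorCoaction, leftCoactionOfRight, antipodeTwist]

/-- Multiplying both arguments of `antipodeTwist` on the right by `t'` and `s'` amounts to applying
a linear map which on `1 ⊗ u` is right multiplication by the twist of `t'` and `s'`. -/
lemma exists_antipodeTwist_mul {A B : Type*} [Ring A] [Algebra K A] [Ring B] [Algebra K B]
    (t' : A ⊗[K] H) (s' : H ⊗[K] B) :
    ∃ Ψ : H ⊗[K] (A ⊗[K] B) →ₗ[K] H ⊗[K] (A ⊗[K] B),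
      (∀ t s, antipodeTwist K H A B ((t * t') ⊗ₜ[K] (s * s')) =
        Ψ (antipodeTwist K H A B (t ⊗ₜ[K] s))) ∧
      ∀ u, Ψ (1 ⊗ₜ[K] u) = (1 ⊗ₜ[K] u) * antipodeTwist K H A B (t' ⊗ₜ[K] s') := by
  induction t' using TensorProduct.induction_on with
  | zero => exact ⟨0, by simp, by simp⟩
  | add x y hx hy =>
    obtain ⟨Ψ₁, h₁, g₁⟩ := hx
    obtain ⟨Ψ₂, h₂, g₂⟩ := hy
    exact ⟨Ψ₁ + Ψ₂, by simp [mul_add, TensorProduct.add_tmul, h₁, h₂],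
      by simp [mul_add, TensorProduct.add_tmul, g₁, g₂]⟩
  | tmul p' k' =>
    induction s' using TensorProduct.induction_on with
    | zero => exact ⟨0, by simp, by simp⟩
    | add x y hx hy =>
      obtain ⟨Ψ₁, h₁, g₁⟩ := hx
      obtain ⟨Ψ₂, h₂, g₂⟩ := hy
      exact ⟨Ψ₁ + Ψ₂, by simp [mul_add, TensorProduct.tmul_add, h₁, h₂],
        by simp [mul_add, TensorProduct.tmul_add, g₁, g₂]⟩
    | tmul h' q' =>
      refine ⟨TensorProduct.map
        (LinearMap.mulLeft K (HopfAlgebra.antipode K k') ∘ₗ LinearMap.mulRight K h')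
        (LinearMap.mulRight K (p' ⊗ₜ[K] q')), fun t s => ?_, fun u => by simp⟩
      induction t using TensorProduct.induction_on with
      | zero => simp
      | add x y hx hy => simp only [add_mul, TensorProduct.add_tmul, map_add, hx, hy]
      | tmul p k =>
        induction s using TensorProduct.induction_on with
        | zero => simp
        | add x y hx hy => simp only [add_mul, TensorProduct.tmul_add, map_add, hx, hy]
        | tmul h q => simp [HopfAlgebra.antipode_mul_antidistrib, mul_assoc]

/-- Left multiplication by a coinvariant element commutes with the coaction on `A ⊗ B`. -/
lemma tensorCoaction_mul_of_mem_coinvariants {A B : Type*} [Ring A] [Algebra K A]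
    [Ring B] [Algebra K B] (ρ : A →ₐ[K] A ⊗[K] H) (lam : B →ₐ[K] H ⊗[K] B) {x : A ⊗[K] B}
    (hx : x ∈ coinvariants K H
      (tensorCoaction K H (leftCoactionOfRight K H ρ.toLinearMap) lam.toLinearMap))
    (y : A ⊗[K] B) :
    tensorCoaction K H (leftCoactionOfRight K H ρ.toLinearMap) lam.toLinearMap (x * y) =
      (1 ⊗ₜ[K] x) *
        tensorCoaction K H (leftCoactionOfRight K H ρ.toLinearMap) lam.toLinearMap y := by
  induction y using TensorProduct.induction_on with
  | zero => simp
  | add y z hy hz => simp only [mul_add, map_add, hy, hz]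
  | tmul a' b' =>
    obtain ⟨Ψ, hΨ, hΨ_one⟩ := exists_antipodeTwist_mul K H (ρ a') (lam b')
    have key (z : A ⊗[K] B) :
        tensorCoaction K H (leftCoactionOfRight K H ρ.toLinearMap) lam.toLinearMap
            (z * a' ⊗ₜ[K] b') =
          Ψ (tensorCoaction K H (leftCoactionOfRight K H ρ.toLinearMap) lam.toLinearMap z) := by
      induction z using TensorProduct.induction_on with
      | zero => simp
      | add z w hz hw => simp only [add_mul, map_add, hz, hw]
      | tmul a b =>
        simp [tensorCoaction_leftCoactionOfRight_tmul, hΨ]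
    rw [key, show _ = _ from hx, hΨ_one, tensorCoaction_leftCoactionOfRight_tmul]
    rfl

/-- **Proposition 1.1.** If `A` is a right `H`-comodule algebra and `B` a left `H`-comodule
algebra, then the coinvariants `(A ⊗ B)^{co H}` of the tensor product left comodule `A ⊗ B`
(where `A` is viewed as a left comodule via `ρ' = τ ∘ (id ⊗ S) ∘ ρ`) form a unital subalgebra
of `A ⊗ B`: they contain `1 ⊗ 1` and are closed under addition, scalar multiplication and
multiplication. -/
theorem coinvariants_subalgebra
    (A : Type*) [Ring A] [Algebra K A] (B : Type*) [Ring B] [Algebra K B]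
    (ρ : A →ₐ[K] A ⊗[K] H) (lam : B →ₐ[K] H ⊗[K] B)
    (hρ : IsRightCoaction K H ρ.toLinearMap)
    (hlam : IsLeftCoaction K H lam.toLinearMap) :
    (1 : A ⊗[K] B) ∈
        coinvariants K H (tensorCoaction K H (leftCoactionOfRight K H ρ.toLinearMap) lam.toLinearMap) ∧
    (∀ x y : A ⊗[K] B,
      x ∈ coinvariants K H (tensorCoaction K H (leftCoactionOfRight K H ρ.toLinearMap) lam.toLinearMap) →
      y ∈ coinvariants K H (tensorCoaction K H (leftCoactionOfRight K H ρ.toLinearMap) lam.toLinearMap) →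
      x + y ∈ coinvariants K H (tensorCoaction K H (leftCoactionOfRight K H ρ.toLinearMap) lam.toLinearMap)) ∧
    (∀ (c : K) (x : A ⊗[K] B),
      x ∈ coinvariants K H (tensorCoaction K H (leftCoactionOfRight K H ρ.toLinearMap) lam.toLinearMap) →
      c • x ∈ coinvariants K H (tensorCoaction K H (leftCoactionOfRight K H ρ.toLinearMap) lam.toLinearMap)) ∧
    (∀ x y : A ⊗[K] B,
      x ∈ coinvariants K H (tensorCoaction K H (leftCoactionOfRight K H ρ.toLinearMap) lam.toLinearMap) →
      y ∈ coinvariants K H (tensorCoaction K H (leftCoactionOfRight K H ρ.toLinearMap) lam.toLinearMap) →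
      x * y ∈ coinvariants K H (tensorCoaction K H (leftCoactionOfRight K H ρ.toLinearMap) lam.toLinearMap)) := by
  refine ⟨?_, fun x y hx hy => ?_, fun c x hx => ?_, fun x y hx hy => ?_⟩
  · change tensorCoaction K H _ _ _ = _
    rw [Algebra.TensorProduct.one_def, tensorCoaction_leftCoactionOfRight_tmul]
    simp [Algebra.TensorProduct.one_def]
  · simp only [coinvariants, Set.mem_ofPred_eq] at *
    rw [map_add, hx, hy, TensorProduct.tmul_add]
  · simp only [coinvariants, Set.mem_ofPred_eq] at *
    rw [map_smul, hx, TensorProduct.tmul_smul]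
  · change tensorCoaction K H _ _ _ = _
    rw [tensorCoaction_mul_of_mem_coinvariants K H ρ lam hx, show _ = _ from hy,
      Algebra.TensorProduct.tmul_mul_tmul, one_mul]
end
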